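/- arXiv:1303.5155 — 2 statements merged into one kernel-verified Lean document; each statement's English description precedes it below -/
import Mathlib

section
/- Let G be a group, P a finite G-poset which is an extension of a G-stable subposet Q by minimal elements, and let M = P \ Q. Then for n >= 1 the map mu from the direct sum over m in M of H~_{n-1}(P_{>m}) to H~_n(P_Q), defined by mu(sum_m [z_m]) = sum_m [m * z_m - 0hat_Q * z_m] where each z_m is an augmented (n-1)-cycle of P_{>m}, is an isomorphism of ZG-modules. -/
/-! Ordered chains, the augmented simplicial chain complex of the order complex of a poset
(given by an arbitrary strict-order relation), reduced homology, and induced maps. -/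

/-- Ordered chains with `n` vertices with respect to a relation `r`
(the `(n-1)`-simplices of the order complex). -/
def OCh (α : Type*) (r : α → α → Prop) (n : ℕ) : Type _ :=
  {f : Fin n → α // ∀ ⦃i j : Fin n⦄, i < j → r (f i) (f j)}

/-- The augmented simplicial chain group with `n`-vertex chains as basis
(`n = 0` gives the augmentation degree `-1`). -/
abbrev ACh (α : Type*) (r : α → α → Prop) (n : ℕ) := OCh α r n →₀ ℤ

/-- The `i`-th face of an `(n+1)`-vertex ordered chain. -/
def OCh.face {α : Type*} {r : α → α → Prop} {n : ℕ} (c : OCh α r (n + 1)) (i : Fin (n + 1)) :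
    OCh α r n :=
  ⟨c.1 ∘ i.succAbove, fun _ _ h => c.2 (Fin.strictMono_succAbove i h)⟩

/-- The simplicial boundary map of the augmented chain complex. -/
noncomputable def bdry (α : Type*) (r : α → α → Prop) (n : ℕ) :
    ACh α r (n + 1) →ₗ[ℤ] ACh α r n :=
  Finsupp.lsum ℤ fun c => LinearMap.toSpanSingleton ℤ _
    (∑ i : Fin (n + 1), ((-1 : ℤ) ^ (i : ℕ)) • Finsupp.single (c.face i) (1 : ℤ))

/-- Augmented `n`-cycles (chains with `n+1` vertices). -/
noncomputable def cyc (α : Type*) (r : α → α → Prop) (n : ℕ) :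
    Submodule ℤ (ACh α r (n + 1)) := LinearMap.ker (bdry α r n)

/-- Augmented `n`-boundaries (chains with `n+1` vertices). -/
noncomputable def bdries (α : Type*) (r : α → α → Prop) (n : ℕ) :
    Submodule ℤ (ACh α r (n + 1)) := LinearMap.range (bdry α r (n + 1))

/-- Reduced simplicial homology `H̃ₙ` (over `ℤ`) of the order complex of `(α, r)`. -/
noncomputable abbrev redH (α : Type*) (r : α → α → Prop) (n : ℕ) :=
  cyc α r n ⧸ (bdries α r n).comap (cyc α r n).subtype

/-- Reduced homology in degree `-1`. -/
noncomputable abbrev redHneg (α : Type*) (r : α → α → Prop) :=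
  (⊤ : Submodule ℤ (ACh α r 0)) ⧸
    (LinearMap.range (bdry α r 0)).comap (⊤ : Submodule ℤ (ACh α r 0)).subtype

section maps

variable {α β : Type*} {rα : α → α → Prop} {rβ : β → β → Prop}

/-- The simplicial map on ordered chains induced by a relation-preserving map. -/
def cmap (f : α → β) (hf : ∀ ⦃a b⦄, rα a b → rβ (f a) (f b)) {n : ℕ} (c : OCh α rα n) :
    OCh β rβ n :=
  ⟨f ∘ c.1, fun _ _ h => hf (c.2 h)⟩

/-- The induced map on augmented chain groups. -/
noncomputable def cmapL (f : α → β) (hf : ∀ ⦃a b⦄, rα a b → rβ (f a) (f b)) (n : ℕ) :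
    ACh α rα n →ₗ[ℤ] ACh β rβ n :=
  Finsupp.lmapDomain ℤ ℤ (cmap f hf)

theorem bdry_single {n : ℕ} (c : OCh α rα (n + 1)) (b : ℤ) :
    bdry α rα n (Finsupp.single c b) =
      b • ∑ i : Fin (n + 1), ((-1 : ℤ) ^ (i : ℕ)) • Finsupp.single (c.face i) (1 : ℤ) := by
  simp [bdry, Finsupp.lsum_single, LinearMap.toSpanSingleton_apply]

theorem face_cmap (f : α → β) (hf : ∀ ⦃a b⦄, rα a b → rβ (f a) (f b)) {n : ℕ}
    (c : OCh α rα (n + 1)) (i : Fin (n + 1)) :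
    (cmap f hf c).face i = cmap f hf (c.face i) := rfl

/-- Naturality of the boundary map. -/
theorem bdry_cmapL (f : α → β) (hf : ∀ ⦃a b⦄, rα a b → rβ (f a) (f b)) (n : ℕ) :
    (bdry β rβ n).comp (cmapL f hf (n + 1)) = (cmapL f hf n).comp (bdry α rα n) := by
  refine Finsupp.lhom_ext fun c b => ?_
  simp only [LinearMap.comp_apply, cmapL, Finsupp.lmapDomain_apply, Finsupp.mapDomain_single,
    bdry_single]
  rw [← Finsupp.lmapDomain_apply ℤ ℤ (cmap f hf), map_smul, map_sum]
  simp [Finsupp.lmapDomain_apply, Finsupp.mapDomain_single, face_cmap]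

theorem cmapL_mem_cyc (f : α → β) (hf : ∀ ⦃a b⦄, rα a b → rβ (f a) (f b)) {n : ℕ}
    {z : ACh α rα (n + 1)} (hz : z ∈ cyc α rα n) :
    cmapL f hf (n + 1) z ∈ cyc β rβ n := by
  have := congrArg (fun φ : ACh α rα (n+1) →ₗ[ℤ] ACh β rβ n => φ z) (bdry_cmapL f hf n)
  simp only [LinearMap.comp_apply] at this
  simp only [cyc, LinearMap.mem_ker] at hz ⊢
  rw [this, hz, map_zero]

/-- The induced map on reduced homology of a relation-preserving map. -/
noncomputable def indH (f : α → β) (hf : ∀ ⦃a b⦄, rα a b → rβ (f a) (f b)) (n : ℕ) :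
    redH α rα n →ₗ[ℤ] redH β rβ n :=
  Submodule.mapQ _ _
    ((cmapL f hf (n + 1)).restrict (fun _ hz => cmapL_mem_cyc f hf hz))
    (by
      rintro ⟨z, hz⟩ hmem
      simp only [Submodule.mem_comap, bdries, LinearMap.mem_range] at hmem ⊢
      obtain ⟨w, hw⟩ := hmem
      refine ⟨cmapL f hf (n + 2) w, ?_⟩
      have := congrArg (fun φ : ACh α rα (n+2) →ₗ[ℤ] ACh β rβ (n+1) => φ w) (bdry_cmapL f hf (n+1))
      simp only [LinearMap.comp_apply] at this
      simp only [LinearMap.restrict_apply]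
      rw [this, hw]
      rfl)

/-- The induced map on reduced homology in degree `-1`. -/
noncomputable def indHneg (f : α → β) (hf : ∀ ⦃a b⦄, rα a b → rβ (f a) (f b)) :
    redHneg α rα →ₗ[ℤ] redHneg β rβ :=
  Submodule.mapQ _ _ ((cmapL f hf 0).restrict (fun _ _ => Submodule.mem_top))
    (by
      rintro ⟨z, hz⟩ hmem
      simp only [Submodule.mem_comap, LinearMap.mem_range] at hmem ⊢
      obtain ⟨w, hw⟩ := hmem
      refine ⟨cmapL f hf 1 w, ?_⟩
      have := congrArg (fun φ : ACh α rα 1 →ₗ[ℤ] ACh β rβ 0 => φ w) (bdry_cmapL f hf 0)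
      simp only [LinearMap.comp_apply] at this
      simp only [LinearMap.restrict_apply]
      rw [this, hw]
      rfl)

/-- Coning off chains with a new bottom vertex `b`. -/
def coneMap (f : α → β) (hf : ∀ ⦃a b⦄, rα a b → rβ (f a) (f b)) (b : β)
    (hb : ∀ a : α, rβ b (f a)) {n : ℕ} (c : OCh α rα n) : OCh β rβ (n + 1) :=
  ⟨Fin.cons b (f ∘ c.1), by
    intro i j hij
    rcases Fin.eq_zero_or_eq_succ j with hj | ⟨j', rfl⟩
    · subst hj; exact absurd hij (Fin.not_lt_zero i)
    · rcases Fin.eq_zero_or_eq_succ i with hi | ⟨i', rfl⟩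
      · subst hi; simpa using hb (c.1 j')
      · have h' : i' < j' := by simpa using hij
        simpa using hf (c.2 h')⟩

/-- The linear extension of `coneMap` to chain groups: `z ↦ b * z`. -/
noncomputable def coneL (f : α → β) (hf : ∀ ⦃a b⦄, rα a b → rβ (f a) (f b)) (b : β)
    (hb : ∀ a : α, rβ b (f a)) (n : ℕ) : ACh α rα n →ₗ[ℤ] ACh β rβ (n + 1) :=
  Finsupp.lmapDomain ℤ ℤ (coneMap f hf b hb)

end maps

section PosetConstructions

/-- The strict order of the poset `P_Q` on `Option P`, where `none` plays the role of the
adjoined minimal element `0̂_Q` lying below exactly the elements of `Q`. -/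
def extRel {P : Type*} (rP : P → P → Prop) (Q : Set P) : Option P → Option P → Prop
  | some x, some y => rP x y
  | none, some y => y ∈ Q
  | _, none => False

/-- The strict order of the poset suspension `Σ R` on `Bool ⊕ R`; `Sum.inl false` and
`Sum.inl true` are the two adjoined elements `0̂_R` and `0̂'_R`, lying below every element
of `R` and incomparable with each other. -/
def suspRel {R : Type*} (rR : R → R → Prop) : Bool ⊕ R → Bool ⊕ R → Prop
  | Sum.inl _, Sum.inr _ => True
  | Sum.inr a, Sum.inr b => rR a b
  | _, _ => False

/-- The underlying set of the wedge of suspensions `⋁_{t ∈ T} Σ Rₜ`: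
`none` is the adjoined minimal element `0̂`, `some (Sum.inl t)` is the element `t ∈ T`, and
`some (Sum.inr ⟨t, x⟩)` is the element `(x, t) ∈ Rₜ × {t}`. -/
abbrev WedgeP (T : Type*) (R : T → Type*) := Option (T ⊕ Σ t, R t)

/-- The strict order of the wedge of suspensions of the posets `Rₜ`. -/
def wRel {T : Type*} {R : T → Type*} (r : ∀ t, R t → R t → Prop) :
    WedgeP T R → WedgeP T R → Prop
  | none, some (Sum.inr _) => True
  | some (Sum.inl t), some (Sum.inr b) => t = b.1
  | some (Sum.inr a), some (Sum.inr b) => ∃ h : a.1 = b.1, r b.1 (h ▸ a.2) b.2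
  | _, _ => False

/-- The order complex of `(α, r)` restricted to the vertex set `S`: the abstract simplicial
complex whose simplices are the finite chains contained in `S`. -/
def cpx (α : Type*) (r : α → α → Prop) (S : Set α) : Set (Finset α) :=
  {s | ↑s ⊆ S ∧ ∀ a ∈ s, ∀ b ∈ s, a ≠ b → r a b ∨ r b a}

/-- The full order complex of `(α, r)`. -/
abbrev fullCpx (α : Type*) (r : α → α → Prop) : Set (Finset α) := cpx α r Set.univ

theorem empty_mem_cpx (α : Type*) (r : α → α → Prop) (S : Set α) : ∅ ∈ cpx α r S := by
  simp [cpx]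

/-- The length of the poset `(α, r)`: the supremum of the lengths of its chains. -/
noncomputable def posetLength (α : Type*) (r : α → α → Prop) : ℕ :=
  sSup {k : ℕ | Nonempty {f : Fin (k+1) → α // ∀ ⦃i j : Fin (k+1)⦄, i < j → r (f i) (f j)}}

theorem extRel_map_QQ {P : Type*} {rP : P → P → Prop} {Q : Set P} :
    ∀ ⦃a b : Option ↥Q⦄,
      extRel (fun x y : ↥Q => rP x y) Set.univ a b →
        extRel rP Q (Option.map Subtype.val a) (Option.map Subtype.val b) := by
  intro a b h
  match a, b with
  | none, some b => exact b.2
  | some a, some b => exact h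
  | none, none => exact h.elim
  | some _, none => exact h.elim

theorem extRel_optionMap {P : Type*} {rP : P → P → Prop} {Q : Set P} {f : P → P}
    (hf : ∀ ⦃a b⦄, rP a b → rP (f a) (f b)) (hfQ : ∀ ⦃q⦄, q ∈ Q → f q ∈ Q) :
    ∀ ⦃a b : Option P⦄, extRel rP Q a b → extRel rP Q (Option.map f a) (Option.map f b) := by
  intro a b h
  match a, b with
  | none, some b => exact hfQ h
  | some a, some b => exact hf h
  | none, none => exact h.elim
  | some _, none => exact h.elim

theorem suspRel_map {R : Type*} {rR : R → R → Prop} {f : R → R}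
    (hf : ∀ ⦃a b⦄, rR a b → rR (f a) (f b)) :
    ∀ ⦃a b : Bool ⊕ R⦄, suspRel rR a b → suspRel rR (Sum.map id f a) (Sum.map id f b) := by
  intro a b h
  match a, b with
  | Sum.inl x, Sum.inr b => trivial
  | Sum.inr a, Sum.inr b => exact hf h
  | Sum.inl x, Sum.inl y => exact h.elim
  | Sum.inr a, Sum.inl y => exact h.elim

theorem wRel_map {T : Type*} {R : T → Type*} {r : ∀ t, R t → R t → Prop}
    (fT : T → T) (fR : ∀ t, R t → R (fT t))
    (hf : ∀ (t : T) ⦃a b : R t⦄, r t a b → r (fT t) (fR t a) (fR t b)) :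
    ∀ ⦃a b : WedgeP T R⦄, wRel r a b →
      wRel r (Option.map (Sum.map fT (fun p => ⟨fT p.1, fR p.1 p.2⟩)) a)
        (Option.map (Sum.map fT (fun p => ⟨fT p.1, fR p.1 p.2⟩)) b) := by
  rintro (_ | (t | ⟨t, x⟩)) (_ | (t' | ⟨t', y⟩)) h <;> try exact h.elim
  · trivial
  · exact congrArg fT h
  · obtain ⟨ht, hr⟩ := h
    dsimp only at ht hr
    subst ht
    exact ⟨rfl, hf t hr⟩

end PosetConstructions

section ExtensionByMinimal

/-- `M = P \ Q`: the set of adjoined minimal elements. -/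
def Mset {P : Type*} (Q : Set P) : Set P := {p | p ∉ Q}

/-- The subposet `P_{> m}` of elements strictly above `m`. -/
abbrev PgtT {P : Type*} [PartialOrder P] {Q : Set P} (m : ↥(Mset Q)) :=
  {x : P // (m : P) < x}

/-- The (strict) order of `P_{> m}`. -/
def rgt {P : Type*} [PartialOrder P] {Q : Set P} (m : ↥(Mset Q)) :
    PgtT m → PgtT m → Prop := fun a b => (a : P) < (b : P)

/-- The wedge of suspensions `⋁_{m ∈ M} Σ P_{>m}` (underlying set). -/
abbrev WT (P : Type*) [PartialOrder P] (Q : Set P) :=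
  WedgeP ↥(Mset Q) (fun m => PgtT m)

/-- The (strict) order of `⋁_{m ∈ M} Σ P_{>m}`. -/
def wrelT (P : Type*) [PartialOrder P] (Q : Set P) : WT P Q → WT P Q → Prop :=
  wRel (fun m => rgt m)

/-- The action of `g ∈ G` on `M = P \ Q`. -/
def gMe {P : Type*} {G : Type*} [Group G] [MulAction G P] {Q : Set P}
    (hQG : ∀ (g : G) (q : P), q ∈ Q → g • q ∈ Q) (g : G) (m : ↥(Mset Q)) : ↥(Mset Q) :=
  ⟨g • (m : P), fun hq => m.2 (by simpa using hQG g⁻¹ _ hq)⟩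

/-- The action of `g ∈ G` on the vertices of `⋁_{m ∈ M} Σ P_{>m}`
(`g • (p, m) = (g • p, g • m)`, `g • m = g • m`, `g • 0̂ = 0̂`). -/
def wVer {P : Type*} [PartialOrder P] {G : Type*} [Group G] [MulAction G P] {Q : Set P}
    (hsmul : ∀ (g : G) ⦃x y : P⦄, x < y → g • x < g • y)
    (hQG : ∀ (g : G) (q : P), q ∈ Q → g • q ∈ Q) (g : G) : WT P Q → WT P Q :=
  Option.map (Sum.map (gMe hQG g)
    (fun p => ⟨gMe hQG g p.1, (⟨g • (p.2 : P), hsmul g p.2.2⟩ : PgtT (gMe hQG g p.1))⟩))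

theorem wVer_mono {P : Type*} [PartialOrder P] {G : Type*} [Group G] [MulAction G P]
    {Q : Set P} (hsmul : ∀ (g : G) ⦃x y : P⦄, x < y → g • x < g • y)
    (hQG : ∀ (g : G) (q : P), q ∈ Q → g • q ∈ Q) (g : G) :
    ∀ ⦃a b : WT P Q⦄, wrelT P Q a b → wrelT P Q (wVer hsmul hQG g a) (wVer hsmul hQG g b) :=
  wRel_map (gMe hQG g)
    (fun (m : ↥(Mset Q)) (x : PgtT m) => (⟨g • (x : P), hsmul g x.2⟩ : PgtT (gMe hQG g m)))
    (fun _ _ _ h => hsmul g h)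

/-- The map from the fibre of the wedge at `g • m` to the fibre at `m` induced by `g⁻¹`
(on suspension vertex sets). -/
def fVer {P : Type*} [PartialOrder P] {G : Type*} [Group G] [MulAction G P] {Q : Set P}
    (hsmul : ∀ (g : G) ⦃x y : P⦄, x < y → g • x < g • y)
    (hQG : ∀ (g : G) (q : P), q ∈ Q → g • q ∈ Q) (g : G) (m : ↥(Mset Q)) :
    Bool ⊕ PgtT (gMe hQG g m) → Bool ⊕ PgtT m :=
  Sum.map id fun p => ⟨g⁻¹ • (p : P), by simpa [gMe] using hsmul g⁻¹ p.2⟩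

end ExtensionByMinimal

open scoped DirectSum

section SumAct

/-- The action of `g ∈ G` on `⊕_{m ∈ M} H̃ₖ(P_{>m})`, permuting the summands. -/
noncomputable def sumAct {P : Type*} [PartialOrder P] [DecidableEq P] {G : Type*} [Group G]
    [MulAction G P] {Q : Set P}
    (hsmul : ∀ (g : G) ⦃x y : P⦄, x < y → g • x < g • y)
    (hQG : ∀ (g : G) (q : P), q ∈ Q → g • q ∈ Q) (k : ℕ) (g : G) :
    (⨁ m : ↥(Mset Q), redH (PgtT m) (rgt m) k) →+
      ⨁ m : ↥(Mset Q), redH (PgtT m) (rgt m) k :=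
  DirectSum.toAddMonoid fun m =>
    ((DirectSum.of (fun m : ↥(Mset Q) => redH (PgtT m) (rgt m) k) (gMe hQG g m)).comp
      (indH (rα := rgt m) (rβ := rgt (gMe hQG g m))
        (fun x : PgtT m => (⟨g • (x : P), hsmul g x.2⟩ : PgtT (gMe hQG g m)))
        (fun _ _ h => hsmul g h) k).toAddMonoidHom)

/-- The stabiliser `G_m` of `m ∈ M` (as a subset of `G`). -/
def stabSet {P : Type*} {G : Type*} [Group G] [MulAction G P] (Q : Set P)
    (m : ↥(Mset Q)) : Set G := {h : G | h • (m : P) = (m : P)}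

/-- The action of the stabiliser `G_m` on `H̃ₖ(P_{>m})`. -/
noncomputable def stabρ {P : Type*} [PartialOrder P] {G : Type*} [Group G] [MulAction G P]
    {Q : Set P} (hsmul : ∀ (g : G) ⦃x y : P⦄, x < y → g • x < g • y)
    (m : ↥(Mset Q)) (k : ℕ) :
    ∀ h : G, h ∈ stabSet Q m →
      (redH (PgtT m) (rgt m) k →+ redH (PgtT m) (rgt m) k) :=
  fun h hh =>
    (indH (rα := rgt m) (rβ := rgt m)
      (fun x : PgtT m => (⟨h • (x : P),
        lt_of_le_of_lt (le_of_eq (show h • (m : P) = (m : P) from hh).symm)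
          (hsmul h x.2)⟩ : PgtT m))
      (fun _ _ hab => hsmul h hab) k).toAddMonoidHom

end SumAct

section ChainLemmas

variable {α β γ δ : Type*} {rα : α → α → Prop} {rβ : β → β → Prop} {rγ : γ → γ → Prop}
  {rδ : δ → δ → Prop}

theorem cmapL_single (f : α → β) (hf : ∀ ⦃a b⦄, rα a b → rβ (f a) (f b)) {n : ℕ}
    (c : OCh α rα n) (a : ℤ) :
    cmapL f hf n (Finsupp.single c a) = Finsupp.single (cmap f hf c) a := by
  simp [cmapL, Finsupp.mapDomain_single]

theorem coneL_single (f : α → β) (hf : ∀ ⦃a b⦄, rα a b → rβ (f a) (f b)) (b : β)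
    (hb : ∀ a : α, rβ b (f a)) {n : ℕ} (c : OCh α rα n) (a : ℤ) :
    coneL f hf b hb n (Finsupp.single c a) = Finsupp.single (coneMap f hf b hb c) a := by
  simp [coneL, Finsupp.mapDomain_single]

theorem face_coneMap_zero (f : α → β) (hf : ∀ ⦃a b⦄, rα a b → rβ (f a) (f b)) (b : β)
    (hb : ∀ a : α, rβ b (f a)) {n : ℕ} (c : OCh α rα n) :
    (coneMap f hf b hb c).face 0 = cmap f hf c := by
  apply Subtype.ext
  funext i
  simp [OCh.face, coneMap, cmap]

theorem face_coneMap_succ (f : α → β) (hf : ∀ ⦃a b⦄, rα a b → rβ (f a) (f b)) (b : β)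
    (hb : ∀ a : α, rβ b (f a)) {n : ℕ} (c : OCh α rα (n + 1)) (i : Fin (n + 1)) :
    (coneMap f hf b hb c).face i.succ = coneMap f hf b hb (c.face i) := by
  apply Subtype.ext
  funext j
  refine Fin.cases ?_ (fun j => ?_) j <;> simp [OCh.face, coneMap, Fin.removeNth]

/-- The boundary of a cone: `∂(b * z) = z - b * ∂z`. -/
theorem bdry_coneL (f : α → β) (hf : ∀ ⦃a b⦄, rα a b → rβ (f a) (f b)) (b : β)
    (hb : ∀ a : α, rβ b (f a)) (n : ℕ) (z : ACh α rα (n + 1)) :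
    bdry β rβ (n + 1) (coneL f hf b hb (n + 1) z) =
      cmapL f hf (n + 1) z - coneL f hf b hb n (bdry α rα n z) := by
  suffices h : (bdry β rβ (n + 1)).comp (coneL f hf b hb (n + 1)) =
      cmapL f hf (n + 1) - (coneL f hf b hb n).comp (bdry α rα n) from
    LinearMap.congr_fun h z
  refine Finsupp.lhom_ext fun c a => ?_
  simp only [LinearMap.comp_apply, LinearMap.sub_apply, coneL_single, cmapL_single, bdry_single,
    map_smul, map_sum]
  rw [Fin.sum_univ_succ]
  simp only [face_coneMap_zero, face_coneMap_succ, Fin.val_zero, Fin.val_succ, pow_zero, pow_succ,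
    one_smul, mul_neg, mul_one, neg_smul, Finset.sum_neg_distrib, smul_add, smul_neg,
    Finsupp.smul_single, smul_eq_mul, sub_eq_add_neg]

theorem coneL_cmapL (e : γ → α) (he : ∀ ⦃a b⦄, rγ a b → rα (e a) (e b)) (f : α → β)
    (hf : ∀ ⦃a b⦄, rα a b → rβ (f a) (f b)) (b : β) (hb : ∀ a : α, rβ b (f a)) (n : ℕ)
    (z : ACh γ rγ n) :
    coneL f hf b hb n (cmapL e he n z) =
      coneL (f ∘ e) (fun _ _ h => hf (he h)) b (fun a => hb (e a)) n z := by
  suffices h : (coneL f hf b hb n).comp (cmapL e he n) =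
      coneL (f ∘ e) (fun _ _ h => hf (he h)) b (fun a => hb (e a)) n from
    LinearMap.congr_fun h z
  refine Finsupp.lhom_ext fun c a => ?_
  simp only [LinearMap.comp_apply, coneL_single, cmapL_single]
  rfl

theorem cmapL_cmapL (e : γ → α) (he : ∀ ⦃a b⦄, rγ a b → rα (e a) (e b)) (f : α → β)
    (hf : ∀ ⦃a b⦄, rα a b → rβ (f a) (f b)) (n : ℕ) (z : ACh γ rγ n) :
    cmapL f hf n (cmapL e he n z) = cmapL (f ∘ e) (fun _ _ h => hf (he h)) n z := by
  suffices h : (cmapL f hf n).comp (cmapL e he n) =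
      cmapL (f ∘ e) (fun _ _ h => hf (he h)) n from
    LinearMap.congr_fun h z
  refine Finsupp.lhom_ext fun c a => ?_
  simp only [LinearMap.comp_apply, cmapL_single]
  rfl

theorem cmapL_coneL (f : α → β) (hf : ∀ ⦃a b⦄, rα a b → rβ (f a) (f b)) (b : β)
    (hb : ∀ a : α, rβ b (f a)) (g : β → δ) (hg : ∀ ⦃a b⦄, rβ a b → rδ (g a) (g b)) (n : ℕ)
    (z : ACh α rα n) :
    cmapL g hg (n + 1) (coneL f hf b hb n z) =
      coneL (g ∘ f) (fun _ _ h => hg (hf h)) (g b) (fun a => hg (hb a)) n z := by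
  suffices h : (cmapL g hg (n + 1)).comp (coneL f hf b hb n) =
      coneL (g ∘ f) (fun _ _ h => hg (hf h)) (g b) (fun a => hg (hb a)) n from
    LinearMap.congr_fun h z
  refine Finsupp.lhom_ext fun c a => ?_
  simp only [LinearMap.comp_apply, coneL_single, cmapL_single]
  congr 1
  apply Subtype.ext
  funext j
  refine Fin.cases ?_ (fun j => ?_) j <;> simp [cmap, coneMap]

theorem cmap_injective (f : α → β) (hf : ∀ ⦃a b⦄, rα a b → rβ (f a) (f b))
    (hinj : Function.Injective f) (n : ℕ) :
    Function.Injective (cmap f hf : OCh α rα n → OCh β rβ n) := by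
  intro c d h
  apply Subtype.ext
  funext i
  exact hinj (congrFun (congrArg Subtype.val h) i)

theorem coneMap_injective (f : α → β) (hf : ∀ ⦃a b⦄, rα a b → rβ (f a) (f b)) (b : β)
    (hb : ∀ a : α, rβ b (f a)) (hinj : Function.Injective f) (n : ℕ) :
    Function.Injective (coneMap f hf b hb : OCh α rα n → OCh β rβ (n + 1)) := by
  intro c d h
  apply Subtype.ext
  funext i
  exact hinj (by simpa [coneMap] using congrFun (congrArg Subtype.val h) i.succ)

theorem lcomapDomain_lmapDomain {X Y : Type*} (f : X → Y) (hf : Function.Injective f)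
    (z : X →₀ ℤ) :
    Finsupp.lcomapDomain (R := ℤ) (M := ℤ) f hf (Finsupp.lmapDomain ℤ ℤ f z) = z :=
  Finsupp.comapDomain_mapDomain f hf z

theorem lcomapDomain_lmapDomain_of_ne {X Y Z : Type*} (f : X → Y) (hf : Function.Injective f)
    (g : Z → Y) (hne : ∀ x z, f x ≠ g z) (z : Z →₀ ℤ) :
    Finsupp.lcomapDomain (R := ℤ) (M := ℤ) f hf (Finsupp.lmapDomain ℤ ℤ g z) = 0 := by
  ext x
  exact Finsupp.mapDomain_of_notMem_range _ _ (by rintro ⟨w, hw⟩; exact hne x w hw.symm)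

/-- The map on reduced homology induced by a linear map of chain groups which preserves cycles
and boundaries. -/
noncomputable def chainH {n k : ℕ} (F : ACh α rα (n + 1) →ₗ[ℤ] ACh β rβ (k + 1))
    (hc : ∀ z ∈ cyc α rα n, F z ∈ cyc β rβ k)
    (hb : ∀ z ∈ bdries α rα n, F z ∈ bdries β rβ k) : redH α rα n →ₗ[ℤ] redH β rβ k :=
  Submodule.mapQ _ _ (F.restrict hc) fun z hz => hb z.1 hz

theorem chainH_mk {n k : ℕ} (F : ACh α rα (n + 1) →ₗ[ℤ] ACh β rβ (k + 1))
    (hc : ∀ z ∈ cyc α rα n, F z ∈ cyc β rβ k)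
    (hb : ∀ z ∈ bdries α rα n, F z ∈ bdries β rβ k) (z : cyc α rα n) :
    chainH F hc hb (Submodule.Quotient.mk z) = Submodule.Quotient.mk ⟨F z, hc z z.2⟩ := rfl

theorem indH_mk (f : α → β) (hf : ∀ ⦃a b⦄, rα a b → rβ (f a) (f b)) (n : ℕ)
    (z : cyc α rα n) :
    indH f hf n (Submodule.Quotient.mk z) =
      Submodule.Quotient.mk ⟨cmapL f hf (n + 1) z, cmapL_mem_cyc f hf z.2⟩ := rfl

theorem chainH_indH {n k : ℕ} (F : ACh α rα (n + 1) →ₗ[ℤ] ACh β rβ (k + 1))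
    (hc : ∀ z ∈ cyc α rα n, F z ∈ cyc β rβ k)
    (hb : ∀ z ∈ bdries α rα n, F z ∈ bdries β rβ k)
    (F' : ACh γ rγ (n + 1) →ₗ[ℤ] ACh δ rδ (k + 1))
    (hc' : ∀ z ∈ cyc γ rγ n, F' z ∈ cyc δ rδ k)
    (hb' : ∀ z ∈ bdries γ rγ n, F' z ∈ bdries δ rδ k)
    (f : α → γ) (hf : ∀ ⦃a b⦄, rα a b → rγ (f a) (f b))
    (g : β → δ) (hg : ∀ ⦃a b⦄, rβ a b → rδ (g a) (g b))
    (hcomm : ∀ z, F' (cmapL f hf (n + 1) z) = cmapL g hg (k + 1) (F z)) (x : redH α rα n) :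
    chainH F' hc' hb' (indH f hf n x) = indH g hg k (chainH F hc hb x) := by
  obtain ⟨z, rfl⟩ := Submodule.Quotient.mk_surjective _ x
  rw [indH_mk, chainH_mk, chainH_mk, indH_mk]
  congr 1
  exact Subtype.ext (hcomm z)

theorem redH_mk_eq_iff {n : ℕ} (z w : cyc α rα n) :
    (Submodule.Quotient.mk z : redH α rα n) = Submodule.Quotient.mk w ↔
      (z : ACh α rα (n + 1)) - w ∈ bdries α rα n := by
  rw [Submodule.Quotient.eq]
  rfl

end ChainLemmas

section ExtensionChains

theorem someVal_injective {P : Type*} {p : P → Prop} :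
    Function.Injective (fun x : {x // p x} => some (x : P)) :=
  (Option.some_injective P).comp Subtype.val_injective

variable {P : Type*} [PartialOrder P] {Q : Set P}

/-- The strict order of `Q`. -/
def ltQ (Q : Set P) : Q → Q → Prop := fun a b => (a : P) < b

theorem extRel_some_of_ltQ ⦃a b : Q⦄ (h : ltQ Q a b) :
    extRel (· < ·) Q (some (a : P)) (some (b : P)) := h

theorem extRel_some_of_rgt {m : Mset Q} ⦃a b : PgtT m⦄ (h : rgt m a b) :
    extRel (· < ·) Q (some (a : P)) (some (b : P)) := h

theorem extRel_some_of_gt {m : Mset Q} (a : PgtT m) :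
    extRel (· < ·) Q (some (m : P)) (some (a : P)) := a.2

theorem extRel_none_some (a : Q) : extRel (· < ·) Q none (some (a : P)) := a.2

/-- The inclusion of `P_{>m}` into `Q`. -/
def gtQ (hmin : ∀ p : P, p ∈ Q ∨ ∀ x : P, ¬ x < p) (m : Mset Q) (x : PgtT m) : Q :=
  ⟨x, (hmin (x : P)).resolve_right fun hc => hc m x.2⟩

theorem ltQ_of_rgt (hmin : ∀ p : P, p ∈ Q ∨ ∀ x : P, ¬ x < p) {m : Mset Q} ⦃a b : PgtT m⦄
    (h : rgt m a b) : ltQ Q (gtQ hmin m a) (gtQ hmin m b) := h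

/-- Chains of `Q` as chains of `P_Q`. -/
noncomputable def inclQ (Q : Set P) (n : ℕ) :
    ACh Q (ltQ Q) n →ₗ[ℤ] ACh (Option P) (extRel (· < ·) Q) n :=
  cmapL (fun x : Q => some (x : P)) extRel_some_of_ltQ n

/-- The cone `0̂_Q * z` on a chain `z` of `Q`. -/
noncomputable def coneQ (Q : Set P) (n : ℕ) :
    ACh Q (ltQ Q) n →ₗ[ℤ] ACh (Option P) (extRel (· < ·) Q) (n + 1) :=
  coneL (fun x : Q => some (x : P)) extRel_some_of_ltQ none extRel_none_some n

/-- The cone `m * z` on a chain `z` of `P_{>m}`. -/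
noncomputable def coneM (m : Mset Q) (n : ℕ) :
    ACh (PgtT m) (rgt m) n →ₗ[ℤ] ACh (Option P) (extRel (· < ·) Q) (n + 1) :=
  coneL (fun x : PgtT m => some (x : P)) extRel_some_of_rgt (some (m : P)) extRel_some_of_gt n

/-- The inclusion of the chains of `P_{>m}` into those of `Q`. -/
noncomputable def gtToQ (hmin : ∀ p : P, p ∈ Q ∨ ∀ x : P, ¬ x < p) (m : Mset Q) (n : ℕ) :
    ACh (PgtT m) (rgt m) n →ₗ[ℤ] ACh Q (ltQ Q) n :=
  cmapL (gtQ hmin m) (ltQ_of_rgt hmin) n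

/-- The chain map `z ↦ m * z - 0̂_Q * z`. -/
noncomputable def suspM (hmin : ∀ p : P, p ∈ Q ∨ ∀ x : P, ¬ x < p) (m : Mset Q) (n : ℕ) :
    ACh (PgtT m) (rgt m) n →ₗ[ℤ] ACh (Option P) (extRel (· < ·) Q) (n + 1) :=
  coneM m n - (coneQ Q n).comp (gtToQ hmin m n)

/-- The part of a chain of `P_Q` lying in `Q`. -/
noncomputable def projQ (Q : Set P) (n : ℕ) :
    ACh (Option P) (extRel (· < ·) Q) n →ₗ[ℤ] ACh Q (ltQ Q) n :=
  Finsupp.lcomapDomain _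
    (cmap_injective (fun x : Q => some (x : P)) extRel_some_of_ltQ someVal_injective n)

/-- The link of `m` in a chain of `P_Q`: the chain `z` of `P_{>m}` such that `m * z` is the part
starting at `m`. -/
noncomputable def linkM (m : Mset Q) (n : ℕ) :
    ACh (Option P) (extRel (· < ·) Q) (n + 1) →ₗ[ℤ] ACh (PgtT m) (rgt m) n :=
  Finsupp.lcomapDomain _
    (coneMap_injective (fun x : PgtT m => some (x : P)) extRel_some_of_rgt (some (m : P))
      extRel_some_of_gt someVal_injective n)

theorem projQ_inclQ (n : ℕ) (z) : projQ Q n (inclQ Q n z) = z :=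
  lcomapDomain_lmapDomain _ _ z

theorem projQ_coneQ (n : ℕ) (z) : projQ Q (n + 1) (coneQ Q n z) = 0 :=
  lcomapDomain_lmapDomain_of_ne _ _ _ (fun c d h => by
    simpa [cmap, coneMap] using congrFun (congrArg Subtype.val h) 0) z

theorem projQ_coneM (m : Mset Q) (n : ℕ) (z) : projQ Q (n + 1) (coneM m n z) = 0 :=
  lcomapDomain_lmapDomain_of_ne _ _ _ (fun c d h => by
    have h' : (c.1 0 : P) = m := by
      simpa [cmap, coneMap] using congrFun (congrArg Subtype.val h) 0
    exact m.2 (h' ▸ (c.1 0).2)) z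

theorem linkM_inclQ (m : Mset Q) (n : ℕ) (z) : linkM m n (inclQ Q (n + 1) z) = 0 :=
  lcomapDomain_lmapDomain_of_ne _ _ _ (fun c d h => by
    have h' : (m : P) = d.1 0 := by
      simpa [cmap, coneMap] using congrFun (congrArg Subtype.val h) 0
    exact m.2 (h' ▸ (d.1 0).2)) z

theorem linkM_coneQ (m : Mset Q) (n : ℕ) (z) : linkM m n (coneQ Q n z) = 0 :=
  lcomapDomain_lmapDomain_of_ne _ _ _ (fun c d h => by
    simpa [coneMap] using congrFun (congrArg Subtype.val h) 0) z

theorem linkM_coneM (m : Mset Q) (n : ℕ) (z) : linkM m n (coneM m n z) = z :=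
  lcomapDomain_lmapDomain _ _ z

theorem linkM_coneM_of_ne {m m' : Mset Q} (hne : m ≠ m') (n : ℕ) (z) :
    linkM m n (coneM m' n z) = 0 :=
  lcomapDomain_lmapDomain_of_ne _ _ _ (fun c d h => by
    have h' : (m : P) = m' := by
      simpa [coneMap] using congrFun (congrArg Subtype.val h) 0
    exact hne (Subtype.ext h')) z

theorem bdry_inclQ (n : ℕ) (z) :
    bdry (Option P) (extRel (· < ·) Q) n (inclQ Q (n + 1) z) = inclQ Q n (bdry _ _ n z) :=
  LinearMap.congr_fun (bdry_cmapL (fun x : Q => some (x : P)) extRel_some_of_ltQ n) z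

theorem bdry_coneQ (n : ℕ) (z) :
    bdry (Option P) (extRel (· < ·) Q) (n + 1) (coneQ Q (n + 1) z) =
      inclQ Q (n + 1) z - coneQ Q n (bdry _ _ n z) :=
  bdry_coneL _ _ _ _ n z

theorem bdry_coneM (hmin : ∀ p : P, p ∈ Q ∨ ∀ x : P, ¬ x < p) (m : Mset Q) (n : ℕ) (z) :
    bdry (Option P) (extRel (· < ·) Q) (n + 1) (coneM m (n + 1) z) =
      inclQ Q (n + 1) (gtToQ hmin m (n + 1) z) - coneM m n (bdry _ _ n z) := by
  rw [coneM, bdry_coneL, inclQ, gtToQ, cmapL_cmapL]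
  rfl

theorem bdry_gtToQ (hmin : ∀ p : P, p ∈ Q ∨ ∀ x : P, ¬ x < p) (m : Mset Q) (n : ℕ) (z) :
    bdry _ _ n (gtToQ hmin m (n + 1) z) = gtToQ hmin m n (bdry _ _ n z) :=
  LinearMap.congr_fun (bdry_cmapL _ _ n) z

theorem bdry_suspM (hmin : ∀ p : P, p ∈ Q ∨ ∀ x : P, ¬ x < p) (m : Mset Q) (n : ℕ) (z) :
    bdry (Option P) (extRel (· < ·) Q) (n + 1) (suspM hmin m (n + 1) z) =
      -suspM hmin m n (bdry _ _ n z) := by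
  simp only [suspM, LinearMap.sub_apply, LinearMap.comp_apply, map_sub, bdry_coneM hmin,
    bdry_coneQ, bdry_gtToQ]
  abel

/-- Linear maps on the chains of `P_Q` agree if they agree on the chains of `Q`, on the cones
`0̂_Q * z` and on the cones `m * z`. -/
theorem extChain_hom_ext (hmin : ∀ p : P, p ∈ Q ∨ ∀ x : P, ¬ x < p) {A : Type*} [AddCommGroup A]
    {n : ℕ} {F F' : ACh (Option P) (extRel (· < ·) Q) (n + 1) →ₗ[ℤ] A}
    (h₁ : ∀ z, F (inclQ Q (n + 1) z) = F' (inclQ Q (n + 1) z))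
    (h₂ : ∀ z, F (coneQ Q n z) = F' (coneQ Q n z))
    (h₃ : ∀ (m : Mset Q) (z), F (coneM m n z) = F' (coneM m n z)) : F = F' := by
  refine Finsupp.lhom_ext fun c a => ?_
  have htail : ∀ i : Fin n, ∃ q ∈ Q, c.1 i.succ = some q := by
    intro i
    have h := c.2 (Fin.succ_pos i)
    match h0 : c.1 0, hi : c.1 i.succ with
    | none, some y => rw [h0, hi] at h; exact ⟨y, h, rfl⟩
    | some x, some y =>
      rw [h0, hi] at h
      exact ⟨y, (hmin y).resolve_right fun hc => hc x h, rfl⟩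
    | none, none => rw [h0, hi] at h; exact h.elim
    | some x, none => rw [h0, hi] at h; exact h.elim
  choose t htQ ht using htail
  have hlt : ∀ ⦃i j : Fin n⦄, i < j → t i < t j := by
    intro i j hij
    have h := c.2 (Fin.succ_lt_succ_iff.2 hij)
    rw [ht, ht] at h
    exact h
  have hltQ : ∀ ⦃i j : Fin n⦄, i < j → ltQ Q ⟨t i, htQ i⟩ ⟨t j, htQ j⟩ := hlt
  match h0 : c.1 0 with
  | none =>
    obtain ⟨d, hd⟩ : ∃ d : OCh Q (ltQ Q) n, coneMap (fun x : Q => some (x : P))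
        extRel_some_of_ltQ none extRel_none_some d = c := by
      refine ⟨⟨fun i => ⟨t i, htQ i⟩, hltQ⟩, Subtype.ext (funext fun j => ?_)⟩
      refine Fin.cases ?_ (fun j => ?_) j <;> simp [coneMap, h0, ht]
    have hc : Finsupp.single c a = coneQ Q n (Finsupp.single d a) := by
      rw [coneQ, coneL_single, hd]
    rw [hc, h₂]
  | some x =>
    have hxt : ∀ i, x < t i := by
      intro i
      have h := c.2 (Fin.succ_pos i)
      rw [h0, ht] at h
      exact h
    by_cases hx : x ∈ Q
    · have hxtQ : ∀ i, ltQ Q ⟨x, hx⟩ ⟨t i, htQ i⟩ := hxt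
      obtain ⟨d, hd⟩ : ∃ d : OCh Q (ltQ Q) (n + 1), cmap (fun x : Q => some (x : P))
          extRel_some_of_ltQ d = c := by
        refine ⟨⟨Fin.cons ⟨x, hx⟩ fun i => ⟨t i, htQ i⟩, fun i j h => ?_⟩,
          Subtype.ext (funext fun j => ?_)⟩
        · induction i using Fin.cases <;> induction j using Fin.cases
          · exact absurd h (lt_irrefl _)
          · simpa using hxtQ _
          · exact absurd h (Fin.not_lt_zero _)
          · simpa using hltQ (Fin.succ_lt_succ_iff.1 h)
        · refine Fin.cases ?_ (fun j => ?_) j <;> simp [cmap, h0, ht]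
      have hc : Finsupp.single c a = inclQ Q (n + 1) (Finsupp.single d a) := by
        rw [inclQ, cmapL_single, hd]
      rw [hc, h₁]
    · obtain ⟨m, rfl⟩ : ∃ m : Mset Q, (m : P) = x := ⟨⟨x, hx⟩, rfl⟩
      obtain ⟨d, hd⟩ : ∃ d : OCh (PgtT m) (rgt m) n, coneMap (fun x : PgtT m => some (x : P))
          extRel_some_of_rgt (some (m : P)) extRel_some_of_gt d = c := by
        refine ⟨⟨fun i => ⟨t i, hxt i⟩, fun _ _ h => hlt h⟩, Subtype.ext (funext fun j => ?_)⟩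
        refine Fin.cases ?_ (fun j => ?_) j <;> simp [coneMap, h0, ht]
      have hc : Finsupp.single c a = coneM m n (Finsupp.single d a) := by
        rw [coneM, coneL_single, hd]
      rw [hc, h₃]

theorem bdry_linkM (hmin : ∀ p : P, p ∈ Q ∨ ∀ x : P, ¬ x < p) (m : Mset Q) (n : ℕ) (w) :
    bdry (PgtT m) (rgt m) n (linkM m (n + 1) w) =
      -linkM m n (bdry (Option P) (extRel (· < ·) Q) (n + 1) w) := by
  suffices h : (bdry (PgtT m) (rgt m) n).comp (linkM m (n + 1)) =
      -(linkM m n).comp (bdry (Option P) (extRel (· < ·) Q) (n + 1)) from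
    LinearMap.congr_fun h w
  refine extChain_hom_ext hmin (fun z => ?_) (fun z => ?_) fun m' z => ?_
  · simp [bdry_inclQ, linkM_inclQ]
  · simp [bdry_coneQ, linkM_inclQ, linkM_coneQ]
  · rcases eq_or_ne m m' with rfl | hne
    · simp [bdry_coneM hmin, linkM_inclQ, linkM_coneM]
    · simp [bdry_coneM hmin, linkM_inclQ, linkM_coneM_of_ne hne]

theorem linkM_suspM (hmin : ∀ p : P, p ∈ Q ∨ ∀ x : P, ¬ x < p) (m : Mset Q) (n : ℕ) (z) :
    linkM m n (suspM hmin m n z) = z := by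
  simp [suspM, linkM_coneM, linkM_coneQ]

theorem linkM_suspM_of_ne (hmin : ∀ p : P, p ∈ Q ∨ ∀ x : P, ¬ x < p) {m m' : Mset Q}
    (hne : m ≠ m') (n : ℕ) (z) : linkM m n (suspM hmin m' n z) = 0 := by
  simp [suspM, linkM_coneM_of_ne hne, linkM_coneQ]

/-- The chain homotopy `w ↦ 0̂_Q * w|_Q` between the identity and `w ↦ ∑ₘ (m - 0̂_Q) * linkₘ w`. -/
theorem extChain_homotopy [Fintype (Mset Q)] (hmin : ∀ p : P, p ∈ Q ∨ ∀ x : P, ¬ x < p)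
    (n : ℕ) (w : ACh (Option P) (extRel (· < ·) Q) (n + 2)) :
    w - ∑ m, suspM hmin m (n + 1) (linkM m (n + 1) w) =
      bdry _ _ (n + 2) (coneQ Q (n + 2) (projQ Q (n + 2) w)) +
        coneQ Q (n + 1) (projQ Q (n + 1) (bdry _ _ (n + 1) w)) := by
  suffices h : LinearMap.id - ∑ m, (suspM hmin m (n + 1)).comp (linkM m (n + 1)) =
      (bdry _ _ (n + 2)).comp ((coneQ Q (n + 2)).comp (projQ Q (n + 2))) +
        (coneQ Q (n + 1)).comp ((projQ Q (n + 1)).comp (bdry _ _ (n + 1))) by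
    simpa [LinearMap.sum_apply] using LinearMap.congr_fun h w
  refine extChain_hom_ext hmin (fun z => ?_) (fun z => ?_) fun m' z => ?_
  · simp [LinearMap.sum_apply, linkM_inclQ, projQ_inclQ, bdry_coneQ, bdry_inclQ]
  · simp [LinearMap.sum_apply, linkM_coneQ, projQ_coneQ, bdry_coneQ, projQ_inclQ]
  · simp only [LinearMap.sub_apply, LinearMap.add_apply, LinearMap.sum_apply, LinearMap.comp_apply,
      LinearMap.id_apply]
    rw [Finset.sum_eq_single m' (fun m _ hne => by rw [linkM_coneM_of_ne hne, map_zero])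
      (by simp)]
    simp [linkM_coneM, projQ_coneM, bdry_coneM hmin, projQ_inclQ, suspM]

theorem suspM_mem_cyc (hmin : ∀ p : P, p ∈ Q ∨ ∀ x : P, ¬ x < p) (m : Mset Q) (k : ℕ)
    (z) (hz : z ∈ cyc (PgtT m) (rgt m) k) :
    suspM hmin m (k + 1) z ∈ cyc (Option P) (extRel (· < ·) Q) (k + 1) := by
  rw [cyc, LinearMap.mem_ker] at hz ⊢
  rw [bdry_suspM, hz, map_zero, neg_zero]

/-- The map `H̃ₖ(P_{>m}) → H̃ₖ₊₁(P_Q)` induced by `z ↦ m * z - 0̂_Q * z`. -/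
noncomputable def suspH (hmin : ∀ p : P, p ∈ Q ∨ ∀ x : P, ¬ x < p) (m : Mset Q) (k : ℕ) :
    redH (PgtT m) (rgt m) k →ₗ[ℤ] redH (Option P) (extRel (· < ·) Q) (k + 1) :=
  chainH (suspM hmin m (k + 1)) (suspM_mem_cyc hmin m k) (by
    rintro _ ⟨y, rfl⟩
    exact ⟨-suspM hmin m (k + 2) y, by rw [map_neg, bdry_suspM, neg_neg]⟩)

theorem linkM_mem_cyc (hmin : ∀ p : P, p ∈ Q ∨ ∀ x : P, ¬ x < p) (m : Mset Q) (k : ℕ)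
    (w) (hw : w ∈ cyc (Option P) (extRel (· < ·) Q) (k + 1)) :
    linkM m (k + 1) w ∈ cyc (PgtT m) (rgt m) k := by
  rw [cyc, LinearMap.mem_ker] at hw ⊢
  rw [bdry_linkM hmin, hw, map_zero, neg_zero]

/-- The map `H̃ₖ₊₁(P_Q) → H̃ₖ(P_{>m})` induced by taking links of `m`. -/
noncomputable def linkH (hmin : ∀ p : P, p ∈ Q ∨ ∀ x : P, ¬ x < p) (m : Mset Q) (k : ℕ) :
    redH (Option P) (extRel (· < ·) Q) (k + 1) →ₗ[ℤ] redH (PgtT m) (rgt m) k :=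
  chainH (linkM m (k + 1)) (linkM_mem_cyc hmin m k) (by
    rintro _ ⟨y, rfl⟩
    exact ⟨-linkM m (k + 2) y, by rw [map_neg, bdry_linkM hmin, neg_neg]⟩)

theorem linkH_suspH (hmin : ∀ p : P, p ∈ Q ∨ ∀ x : P, ¬ x < p) (m : Mset Q) (k : ℕ) (x) :
    linkH hmin m k (suspH hmin m k x) = x := by
  obtain ⟨z, rfl⟩ := Submodule.Quotient.mk_surjective _ x
  rw [suspH, chainH_mk, linkH, chainH_mk]
  congr 1
  exact Subtype.ext (linkM_suspM hmin m (k + 1) z)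

theorem linkH_suspH_of_ne (hmin : ∀ p : P, p ∈ Q ∨ ∀ x : P, ¬ x < p) {m m' : Mset Q}
    (hne : m ≠ m') (k : ℕ) (x) : linkH hmin m k (suspH hmin m' k x) = 0 := by
  obtain ⟨z, rfl⟩ := Submodule.Quotient.mk_surjective _ x
  rw [suspH, chainH_mk, linkH, chainH_mk, ← Submodule.Quotient.mk_zero]
  congr 1
  exact Subtype.ext (linkM_suspM_of_ne hmin hne (k + 1) z)

theorem sum_suspH_linkH [Fintype (Mset Q)] (hmin : ∀ p : P, p ∈ Q ∨ ∀ x : P, ¬ x < p) (k : ℕ)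
    (y) : ∑ m, suspH hmin m k (linkH hmin m k y) = y := by
  obtain ⟨w, rfl⟩ := Submodule.Quotient.mk_surjective _ y
  have hw : bdry _ _ (k + 1) w.1 = 0 := w.2
  have hsum : ∑ m, suspH hmin m k (linkH hmin m k (Submodule.Quotient.mk w)) =
      Submodule.Quotient.mk (∑ m : Mset Q, (⟨suspM hmin m (k + 1) (linkM m (k + 1) w.1),
        suspM_mem_cyc hmin m k _ (linkM_mem_cyc hmin m k _ w.2)⟩ :
          cyc (Option P) (extRel (· < ·) Q) (k + 1))) :=
    (map_sum (Submodule.mkQ _) _ _).symm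
  rw [hsum, eq_comm, redH_mk_eq_iff]
  refine ⟨coneQ Q (k + 2) (projQ Q (k + 2) w.1), ?_⟩
  have h := extChain_homotopy hmin k w.1
  rw [hw, map_zero, map_zero, add_zero] at h
  rw [← h]
  simp

theorem suspM_eq_coneL_sub (hmin : ∀ p : P, p ∈ Q ∨ ∀ x : P, ¬ x < p) (m : Mset Q) (n : ℕ)
    (z : ACh (PgtT m) (rgt m) n) :
    suspM hmin m n z =
      coneL (rα := rgt m) (rβ := extRel (· < ·) Q) (fun x : PgtT m => (some (x : P) : Option P))
          (fun _ _ h => h) (some (m : P)) (fun a => a.2) n z -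
        coneL (rα := rgt m) (rβ := extRel (· < ·) Q)
          (fun x : PgtT m => (some (x : P) : Option P)) (fun _ _ h => h) none
          (fun a => (hmin (a : P)).resolve_right (fun hc => hc (m : P) a.2)) n z := by
  rw [suspM, LinearMap.sub_apply, LinearMap.comp_apply, coneQ, gtToQ, coneL_cmapL]
  rfl

/-- The map `⨁ₘ H̃ₖ(P_{>m}) → H̃ₖ₊₁(P_Q)`, `∑ₘ [zₘ] ↦ ∑ₘ [m * zₘ - 0̂_Q * zₘ]`. -/
noncomputable def suspSum [DecidableEq P] (hmin : ∀ p : P, p ∈ Q ∨ ∀ x : P, ¬ x < p) (k : ℕ) :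
    (⨁ m : Mset Q, redH (PgtT m) (rgt m) k) →+
      redH (Option P) (extRel (· < ·) Q) (k + 1) :=
  DirectSum.toAddMonoid fun m => (suspH hmin m k).toAddMonoidHom

theorem suspSum_of [DecidableEq P] (hmin : ∀ p : P, p ∈ Q ∨ ∀ x : P, ¬ x < p) (k : ℕ)
    (m : Mset Q) (x : redH (PgtT m) (rgt m) k) :
    suspSum hmin k (DirectSum.of (fun m : Mset Q => redH (PgtT m) (rgt m) k) m x) =
      suspH hmin m k x :=
  DirectSum.toAddMonoid_of _ _ _

theorem linkH_suspSum [DecidableEq P] (hmin : ∀ p : P, p ∈ Q ∨ ∀ x : P, ¬ x < p) (k : ℕ)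
    (m : Mset Q) (x : ⨁ m : Mset Q, redH (PgtT m) (rgt m) k) :
    linkH hmin m k (suspSum hmin k x) = x m := by
  induction x using DirectSum.induction_on with
  | zero => simp
  | of m' x =>
    rw [suspSum_of]
    rcases eq_or_ne m m' with rfl | hne
    · rw [linkH_suspH, DirectSum.of_eq_same]
    · rw [linkH_suspH_of_ne hmin hne, DirectSum.of_eq_of_ne _ _ _ hne]
  | add x y hx hy => rw [map_add, map_add, hx, hy, DirectSum.add_apply]

theorem suspSum_bijective [Finite P] [DecidableEq P]
    (hmin : ∀ p : P, p ∈ Q ∨ ∀ x : P, ¬ x < p) (k : ℕ) :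
    Function.Bijective (suspSum hmin k) := by
  constructor
  · intro x y h
    refine DFinsupp.ext fun m => ?_
    rw [← linkH_suspSum hmin, h, linkH_suspSum]
  · intro y
    have := Fintype.ofFinite (Mset Q)
    refine ⟨∑ m, DirectSum.of (fun m : Mset Q => redH (PgtT m) (rgt m) k) m (linkH hmin m k y), ?_⟩
    simp only [map_sum, suspSum_of]
    exact sum_suspH_linkH hmin k y

/-- The action of `g` as a map `P_{>m} → P_{>gm}`. -/
def smulGt {G : Type*} [Group G] [MulAction G P]
    (hsmul : ∀ (g : G) ⦃x y : P⦄, x < y → g • x < g • y)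
    (hQG : ∀ (g : G) (q : P), q ∈ Q → g • q ∈ Q) (g : G) (m : Mset Q) (x : PgtT m) :
    PgtT (gMe hQG g m) :=
  ⟨g • (x : P), hsmul g x.2⟩

theorem rgt_smulGt {G : Type*} [Group G] [MulAction G P]
    (hsmul : ∀ (g : G) ⦃x y : P⦄, x < y → g • x < g • y)
    (hQG : ∀ (g : G) (q : P), q ∈ Q → g • q ∈ Q) (g : G) (m : Mset Q) ⦃a b : PgtT m⦄
    (h : rgt m a b) :
    rgt (gMe hQG g m) (smulGt hsmul hQG g m a) (smulGt hsmul hQG g m b) :=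
  hsmul g h

theorem coneM_smul {G : Type*} [Group G] [MulAction G P]
    (hsmul : ∀ (g : G) ⦃x y : P⦄, x < y → g • x < g • y)
    (hQG : ∀ (g : G) (q : P), q ∈ Q → g • q ∈ Q) (g : G) (m : Mset Q) (n : ℕ)
    (z : ACh (PgtT m) (rgt m) n) :
    coneM (gMe hQG g m) n (cmapL (smulGt hsmul hQG g m) (rgt_smulGt hsmul hQG g m) n z) =
      cmapL (Option.map ((g • ·) : P → P)) (extRel_optionMap (hsmul g) (fun q hq => hQG g q hq))
        (n + 1) (coneM m n z) := by
  rw [coneM, coneL_cmapL, coneM, cmapL_coneL]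
  rfl

theorem coneQ_gtToQ_smul {G : Type*} [Group G] [MulAction G P]
    (hsmul : ∀ (g : G) ⦃x y : P⦄, x < y → g • x < g • y)
    (hQG : ∀ (g : G) (q : P), q ∈ Q → g • q ∈ Q)
    (hmin : ∀ p : P, p ∈ Q ∨ ∀ x : P, ¬ x < p) (g : G) (m : Mset Q) (n : ℕ)
    (z : ACh (PgtT m) (rgt m) n) :
    coneQ Q n (gtToQ hmin (gMe hQG g m) n
        (cmapL (smulGt hsmul hQG g m) (rgt_smulGt hsmul hQG g m) n z)) =
      cmapL (Option.map ((g • ·) : P → P)) (extRel_optionMap (hsmul g) (fun q hq => hQG g q hq))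
        (n + 1) (coneQ Q n (gtToQ hmin m n z)) := by
  rw [coneQ, gtToQ, cmapL_cmapL, coneL_cmapL, gtToQ, coneL_cmapL, cmapL_coneL]
  rfl

theorem suspM_smul {G : Type*} [Group G] [MulAction G P]
    (hsmul : ∀ (g : G) ⦃x y : P⦄, x < y → g • x < g • y)
    (hQG : ∀ (g : G) (q : P), q ∈ Q → g • q ∈ Q)
    (hmin : ∀ p : P, p ∈ Q ∨ ∀ x : P, ¬ x < p) (g : G) (m : Mset Q) (n : ℕ)
    (z : ACh (PgtT m) (rgt m) n) :
    suspM hmin (gMe hQG g m) n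
        (cmapL (smulGt hsmul hQG g m) (rgt_smulGt hsmul hQG g m) n z) =
      cmapL (Option.map ((g • ·) : P → P)) (extRel_optionMap (hsmul g) (fun q hq => hQG g q hq))
        (n + 1) (suspM hmin m n z) := by
  simp only [suspM, LinearMap.sub_apply, LinearMap.comp_apply, map_sub, coneM_smul,
    coneQ_gtToQ_smul]

theorem suspSum_sumAct [DecidableEq P] {G : Type*} [Group G] [MulAction G P]
    (hsmul : ∀ (g : G) ⦃x y : P⦄, x < y → g • x < g • y)
    (hQG : ∀ (g : G) (q : P), q ∈ Q → g • q ∈ Q)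
    (hmin : ∀ p : P, p ∈ Q ∨ ∀ x : P, ¬ x < p) (k : ℕ) (g : G)
    (x : ⨁ m : Mset Q, redH (PgtT m) (rgt m) k) :
    suspSum hmin k (sumAct hsmul hQG k g x) =
      indH (rα := extRel (· < ·) Q) (rβ := extRel (· < ·) Q) (Option.map ((g • ·) : P → P))
        (extRel_optionMap (hsmul g) (fun q hq => hQG g q hq)) (k + 1) (suspSum hmin k x) := by
  induction x using DirectSum.induction_on with
  | zero => simp
  | of m x =>
    rw [sumAct, DirectSum.toAddMonoid_of]
    simp only [AddMonoidHom.comp_apply, LinearMap.toAddMonoidHom_coe, suspSum_of]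
    exact chainH_indH _ _ _ _ _ _ (smulGt hsmul hQG g m) (rgt_smulGt hsmul hQG g m) _ _
      (suspM_smul hsmul hQG hmin g m (k + 1)) x
  | add x y hx hy => simp only [map_add, hx, hy]

end ExtensionChains

/-- Segev–Webb, Theorem 2.4(ii).  If the finite `G`-poset `P` is an
extension of the `G`-stable subposet `Q` by minimal elements and `M = P \ Q`, then for
`n = k + 1 ≥ 1` the map `μ : ⊕_{m ∈ M} H̃ₙ₋₁(P_{>m}) → H̃ₙ(P_Q)`,
`μ(Σₘ [zₘ]) = Σₘ [m * zₘ - 0̂_Q * zₘ]`, is an isomorphism of `ℤG`-modules. -/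
theorem statement10 {P : Type*} [PartialOrder P] [Finite P] [DecidableEq P]
    {G : Type*} [Group G] [MulAction G P]
    (hsmul : ∀ (g : G) ⦃x y : P⦄, x < y → g • x < g • y)
    (Q : Set P)
    (hQupper : ∀ q ∈ Q, ∀ p : P, q ≤ p → p ∈ Q)
    (hQext : ∀ p : P, ∃ q ∈ Q, p ≤ q)
    (hQG : ∀ (g : G) (q : P), q ∈ Q → g • q ∈ Q)
    (hmin : ∀ p : P, p ∈ Q ∨ ∀ x : P, ¬ x < p)
    (k : ℕ) :
    ∃ μ : (⨁ m : ↥(Mset Q), redH (PgtT m) (rgt m) k) ≃+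
        redH (Option P) (extRel (· < ·) Q) (k + 1),
      (∀ (m : ↥(Mset Q)) (z : ↥(cyc (PgtT m) (rgt m) k))
        (w : ↥(cyc (Option P) (extRel (· < ·) Q) (k + 1))),
        (w : ACh (Option P) (extRel (· < ·) Q) (k + 2)) =
            coneL (rα := rgt m) (rβ := extRel (· < ·) Q)
              (fun x : PgtT m => (some (x : P) : Option P))
              (fun _ _ h => h) (some (m : P)) (fun a => a.2) (k + 1)
              (z : ACh (PgtT m) (rgt m) (k + 1)) -
            coneL (rα := rgt m) (rβ := extRel (· < ·) Q)
              (fun x : PgtT m => (some (x : P) : Option P))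
              (fun _ _ h => h) none
              (fun a => (hmin (a : P)).resolve_right (fun hc => hc (m : P) a.2)) (k + 1)
              (z : ACh (PgtT m) (rgt m) (k + 1)) →
        μ (DirectSum.of (fun m : ↥(Mset Q) => redH (PgtT m) (rgt m) k) m
            (Submodule.Quotient.mk z)) = Submodule.Quotient.mk w) ∧
      (∀ (g : G) (x : ⨁ m : ↥(Mset Q), redH (PgtT m) (rgt m) k),
        μ (sumAct hsmul hQG k g x) =
          indH (rα := extRel (· < ·) Q) (rβ := extRel (· < ·) Q)
            (Option.map ((g • ·) : P → P))
            (extRel_optionMap (hsmul g) (fun q hq => hQG g q hq)) (k + 1) (μ x)) := by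
  refine ⟨AddEquiv.ofBijective (suspSum hmin k) (suspSum_bijective hmin k), ?_, ?_⟩
  · intro m z w hw
    rw [AddEquiv.ofBijective_apply, suspSum_of, suspH, chainH_mk]
    congr 1
    exact Subtype.ext ((suspM_eq_coneL_sub hmin m (k + 1) z.1).trans hw.symm)
  · exact suspSum_sumAct hsmul hQG hmin k
end

section
/- Suppose gamma G is a unitary reflection coset in V = C^n, zeta is a complex root of unity, and M is the set of maximal eigenspaces of S'_zeta^V(gamma G). Then U'_zeta^V(gamma G) is homotopy equivalent to the wedge of suspensions wedge_{m in M} Sigma((S'_zeta^V(gamma G))_{>m}), and this equivalence is G-equivariant. -/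
section Realization

/-- The geometric realization of an abstract simplicial complex `K` with vertex set `α`,
as a subspace of `α → ℝ`. -/
def Rl {α : Type*} (K : Set (Finset α)) : Set (α → ℝ) :=
  {w | (∀ a, 0 ≤ w a) ∧ ∃ s ∈ K, (∀ a, w a ≠ 0 → a ∈ s) ∧ ∑ a ∈ s, w a = 1}

/-- The two-point simplicial complex (two distinct isolated vertices). -/
def twoPt : Set (Finset Bool) := {s | s.card ≤ 1}

/-- The join of two abstract simplicial complexes. -/
def joinCpx {α β : Type*} [DecidableEq α] [DecidableEq β]
    (K : Set (Finset α)) (L : Set (Finset β)) : Set (Finset (α ⊕ β)) :=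
  {u | ∃ s ∈ K, ∃ t ∈ L,
    u = s.map ⟨Sum.inl, Sum.inl_injective⟩ ∪ t.map ⟨Sum.inr, Sum.inr_injective⟩}

/-- The relation identifying the basepoints of a family of pointed spaces. -/
def wedgeSetoid {T : Type*} (X : T → Type*) (pt : ∀ t, X t) : Setoid (Σ t, X t) where
  r a b := a = b ∨ (a.2 = pt a.1 ∧ b.2 = pt b.1)
  iseqv := by
    refine ⟨fun _ => Or.inl rfl, ?_, ?_⟩
    · rintro a b (rfl | ⟨h1, h2⟩)
      · exact Or.inl rfl
      · exact Or.inr ⟨h2, h1⟩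
    · rintro a b c (rfl | ⟨h1, h2⟩) (rfl | ⟨h3, h4⟩)
      · exact Or.inl rfl
      · exact Or.inr ⟨h3, h4⟩
      · exact Or.inr ⟨h1, h2⟩
      · exact Or.inr ⟨h1, h4⟩

/-- The wedge (one-point union) of a family of pointed topological spaces. -/
def WedgeSpace {T : Type*} (X : T → Type*) [∀ t, TopologicalSpace (X t)] (pt : ∀ t, X t) :=
  Quotient (wedgeSetoid X pt)

noncomputable instance {T : Type*} (X : T → Type*) [∀ t, TopologicalSpace (X t)]
    (pt : ∀ t, X t) : TopologicalSpace (WedgeSpace X pt) := by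
  unfold WedgeSpace; infer_instance

/-- The basepoint (the vertex `0̂` of the suspension) in the realization of the simplicial
suspension of a complex `L`. -/
noncomputable def suspBase {β : Type*} [DecidableEq β] (L : Set (Finset β)) (hL : ∅ ∈ L) :
    ↥(Rl (joinCpx twoPt L)) :=
  ⟨fun a => if a = Sum.inl false then 1 else 0, by
    refine ⟨fun a => ?_, {Sum.inl false}, ⟨{false}, by simp [twoPt], ∅, hL, by simp⟩, ?_, by simp⟩
    · simp only []
      split <;> norm_num
    · intro a ha
      simp only [Finset.mem_singleton]
      by_contra h
      exact ha (if_neg h)⟩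

/-- A basepoint on the `ℓ`-dimensional unit sphere. -/
noncomputable def spherePt (ℓ : ℕ) : ↥(Metric.sphere (0 : EuclideanSpace ℝ (Fin (ℓ+1))) 1) :=
  ⟨EuclideanSpace.single 0 1, by simp⟩

/-- The bouquet (wedge) of `N` spheres of dimension `ℓ`. -/
noncomputable def Bouquet (N ℓ : ℕ) : Type :=
  WedgeSpace (fun _ : Fin N => ↥(Metric.sphere (0 : EuclideanSpace ℝ (Fin (ℓ+1))) 1))
    (fun _ => spherePt ℓ)

noncomputable instance (N ℓ : ℕ) : TopologicalSpace (Bouquet N ℓ) := by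
  unfold Bouquet WedgeSpace; infer_instance

end Realization

section ReflectionGroups

/-- The `ζ`-eigenspace `V(x, ζ)` of `x ∈ GL(V)` acting on `V = ℂⁿ`. -/
noncomputable def eigSp {n : ℕ} (x : Matrix.GeneralLinearGroup (Fin n) ℂ) (ζ : ℂ) :
    Submodule ℂ (Fin n → ℂ) :=
  Module.End.eigenspace (Matrix.toLin' (x : Matrix (Fin n) (Fin n) ℂ)) ζ

/-- The fixed subspace of `g`. -/
noncomputable def fixSp {n : ℕ} (g : Matrix.GeneralLinearGroup (Fin n) ℂ) :
    Submodule ℂ (Fin n → ℂ) := eigSp g 1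

/-- A reflection: a non-identity element whose fixed subspace is a hyperplane. -/
def IsReflection {n : ℕ} (g : Matrix.GeneralLinearGroup (Fin n) ℂ) : Prop :=
  g ≠ 1 ∧ Module.finrank ℂ (fixSp g) = n - 1

/-- A (finite) unitary reflection group in `V = ℂⁿ`. -/
def IsUnitaryReflectionGroup {n : ℕ} (G : Subgroup (Matrix.GeneralLinearGroup (Fin n) ℂ)) :
    Prop :=
  (G : Set (Matrix.GeneralLinearGroup (Fin n) ℂ)).Finite ∧
  (∀ g ∈ G, (g : Matrix (Fin n) (Fin n) ℂ) ∈ Matrix.unitaryGroup (Fin n) ℂ) ∧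
  Subgroup.closure {g | g ∈ G ∧ IsReflection g} = G

/-- `γ` normalises `G`. -/
def Normalises {n : ℕ} (γ : Matrix.GeneralLinearGroup (Fin n) ℂ)
    (G : Subgroup (Matrix.GeneralLinearGroup (Fin n) ℂ)) : Prop :=
  ∀ g, g ∈ G ↔ γ * g * γ⁻¹ ∈ G

/-- The poset `S_ζ^V(γG)` of `ζ`-eigenspaces of elements of the reflection coset `γG`,
to be ordered by the *reverse* of inclusion. -/
def Sset {n : ℕ} (γ : Matrix.GeneralLinearGroup (Fin n) ℂ)
    (G : Subgroup (Matrix.GeneralLinearGroup (Fin n) ℂ)) (ζ : ℂ) :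
    Set (Submodule ℂ (Fin n → ℂ)) :=
  {E | ∃ g ∈ G, E = eigSp (γ * g) ζ}

/-- `S'_ζ^V(γG)`: `S_ζ^V(γG)` with the unique maximal element `1̂` (the smallest eigenspace)
removed. -/
def Sp {n : ℕ} (γ : Matrix.GeneralLinearGroup (Fin n) ℂ)
    (G : Subgroup (Matrix.GeneralLinearGroup (Fin n) ℂ)) (ζ : ℂ) :
    Set (Submodule ℂ (Fin n → ℂ)) :=
  {E ∈ Sset γ G ζ | ∃ F ∈ Sset γ G ζ, ¬ E ≤ F}

/-- `S̃_ζ^V(γG)`: `S_ζ^V(γG)` with the unique maximal element removed, and the unique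
minimal element removed if it exists. -/
def Stilde {n : ℕ} (γ : Matrix.GeneralLinearGroup (Fin n) ℂ)
    (G : Subgroup (Matrix.GeneralLinearGroup (Fin n) ℂ)) (ζ : ℂ) :
    Set (Submodule ℂ (Fin n → ℂ)) :=
  {E ∈ Sset γ G ζ | (∃ F ∈ Sset γ G ζ, ¬ E ≤ F) ∧ (∃ F ∈ Sset γ G ζ, ¬ F ≤ E)}

/-- `T'_ζ^V(γG)`: the non-maximal eigenspaces of `S'_ζ^V(γG)`. -/
def Tp {n : ℕ} (γ : Matrix.GeneralLinearGroup (Fin n) ℂ)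
    (G : Subgroup (Matrix.GeneralLinearGroup (Fin n) ℂ)) (ζ : ℂ) :
    Set (Submodule ℂ (Fin n → ℂ)) :=
  {E ∈ Sp γ G ζ | ∃ F ∈ Sp γ G ζ, E < F}

/-- The set of maximal eigenspaces, `M = S' \ T'`. -/
def Mp {n : ℕ} (γ : Matrix.GeneralLinearGroup (Fin n) ℂ)
    (G : Subgroup (Matrix.GeneralLinearGroup (Fin n) ℂ)) (ζ : ℂ) :
    Set (Submodule ℂ (Fin n → ℂ)) :=
  {E ∈ Sp γ G ζ | ∀ F ∈ Sp γ G ζ, ¬ E < F}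

/-- The strict order of `S'_ζ^V(γG)` (reverse inclusion). -/
def rSp {n : ℕ} (γ : Matrix.GeneralLinearGroup (Fin n) ℂ)
    (G : Subgroup (Matrix.GeneralLinearGroup (Fin n) ℂ)) (ζ : ℂ) :
    ↥(Sp γ G ζ) → ↥(Sp γ G ζ) → Prop :=
  fun E F => F.1 < E.1

/-- The strict order of `U'_ζ^V(γG)` on `Option ↥(S'_ζ^V(γG))`, where `none` is the adjoined
element `0̂_S` lying below exactly the elements of `T'_ζ^V(γG)`. -/
def Urel {n : ℕ} (γ : Matrix.GeneralLinearGroup (Fin n) ℂ)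
    (G : Subgroup (Matrix.GeneralLinearGroup (Fin n) ℂ)) (ζ : ℂ) :
    Option ↥(Sp γ G ζ) → Option ↥(Sp γ G ζ) → Prop
  | some E, some F => F.1 < E.1
  | none, some F => F.1 ∈ Tp γ G ζ
  | _, none => False

end ReflectionGroups

/-- The matrix of an element of a subgroup of `GL(n, ℂ)`. -/
noncomputable abbrev matOf {n : ℕ} {G : Subgroup (Matrix.GeneralLinearGroup (Fin n) ℂ)}
    (g : ↥G) : Matrix (Fin n) (Fin n) ℂ :=
  ((g : Matrix.GeneralLinearGroup (Fin n) ℂ) : Matrix (Fin n) (Fin n) ℂ)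

/-- The subset of `↥(S'_ζᵛ(γG))` corresponding to the set `M` of maximal eigenspaces. -/
def MpSub {n : ℕ} (γ : Matrix.GeneralLinearGroup (Fin n) ℂ)
    (G : Subgroup (Matrix.GeneralLinearGroup (Fin n) ℂ)) (ζ : ℂ) : Set ↥(Sp γ G ζ) :=
  {E : ↥(Sp γ G ζ) | (E : Submodule ℂ (Fin n → ℂ)) ∈ Mp γ G ζ}

/-- The subposet `(S'_ζᵛ(γG))_{> m}` of elements strictly above `m ∈ M`. -/
abbrev SgtT {n : ℕ} (γ : Matrix.GeneralLinearGroup (Fin n) ℂ)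
    (G : Subgroup (Matrix.GeneralLinearGroup (Fin n) ℂ)) (ζ : ℂ) (m : ↥(MpSub γ G ζ)) :=
  {E : ↥(Sp γ G ζ) // rSp γ G ζ (m : ↥(Sp γ G ζ)) E}

/-- The order of `(S'_ζᵛ(γG))_{> m}`. -/
def rgtS {n : ℕ} (γ : Matrix.GeneralLinearGroup (Fin n) ℂ)
    (G : Subgroup (Matrix.GeneralLinearGroup (Fin n) ℂ)) (ζ : ℂ) (m : ↥(MpSub γ G ζ)) :
    SgtT γ G ζ m → SgtT γ G ζ m → Prop :=
  fun a b => rSp γ G ζ a.1 b.1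

noncomputable instance {n : ℕ} : DecidableEq (Submodule ℂ (Fin n → ℂ)) :=
  Classical.decEq _

section ChainComplexes

open scoped Classical in
theorem mem_Rl_fullCpx {α : Type*} [Fintype α] {r : α → α → Prop} {w : α → ℝ} :
    w ∈ Rl (fullCpx α r) ↔ (∀ a, 0 ≤ w a) ∧ ∑ a, w a = 1 ∧
      ∀ a b, w a ≠ 0 → w b ≠ 0 → a ≠ b → r a b ∨ r b a := by
  constructor
  · rintro ⟨h0, s, hs, hsupp, hsum⟩
    refine ⟨h0, ?_, fun a b ha hb hab => hs.2 a (hsupp a ha) b (hsupp b hb) hab⟩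
    rw [← hsum]
    refine (Finset.sum_subset (Finset.subset_univ s) fun x _ hx => ?_).symm
    by_contra h
    exact hx (hsupp x h)
  · rintro ⟨h0, hsum, hc⟩
    refine ⟨h0, Finset.univ.filter (fun a => w a ≠ 0), ⟨by simp, ?_⟩, by simp, ?_⟩
    · intro a ha b hb hab
      exact hc a b (by simpa using ha) (by simpa using hb) hab
    · rw [← hsum]
      exact Finset.sum_filter_ne_zero _

theorem homotopic_of_contiguous {X α : Type*} [TopologicalSpace X] [Finite α]
    {r : α → α → Prop} (f g : C(X, ↥(Rl (fullCpx α r))))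
    (h : ∀ x a b, ((f x).1 a ≠ 0 ∨ (g x).1 a ≠ 0) → ((f x).1 b ≠ 0 ∨ (g x).1 b ≠ 0) →
      a ≠ b → r a b ∨ r b a) : f.Homotopic g := by
  have := Fintype.ofFinite α
  have key : ∀ p : unitInterval × X,
      (fun a => (1 - (p.1 : ℝ)) * (f p.2).1 a + (p.1 : ℝ) * (g p.2).1 a) ∈
        Rl (fullCpx α r) := by
    rintro ⟨t, x⟩
    obtain ⟨hf0, hfs, -⟩ := mem_Rl_fullCpx.1 (f x).2
    obtain ⟨hg0, hgs, -⟩ := mem_Rl_fullCpx.1 (g x).2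
    have ht0 := t.2.1
    have ht1 : 0 ≤ 1 - (t : ℝ) := by linarith [t.2.2]
    refine mem_Rl_fullCpx.2 ⟨fun a => ?_, ?_, fun a b ha hb => h x a b ?_ ?_⟩
    · have := hf0 a
      have := hg0 a
      positivity
    · rw [Finset.sum_add_distrib, ← Finset.mul_sum, ← Finset.mul_sum, hfs, hgs]
      ring
    · by_contra! hn
      exact ha (by simp [hn.1, hn.2])
    · by_contra! hn
      exact hb (by simp [hn.1, hn.2])
  exact ⟨{ toFun := fun p => ⟨_, key p⟩
           continuous_toFun := by
             refine Continuous.subtype_mk (continuous_pi fun a => ?_) _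
             have hf : Continuous fun p : unitInterval × X => (f p.2).1 a :=
               (continuous_apply a).comp (continuous_subtype_val.comp (f.continuous.comp continuous_snd))
             have hg : Continuous fun p : unitInterval × X => (g p.2).1 a :=
               (continuous_apply a).comp (continuous_subtype_val.comp (g.continuous.comp continuous_snd))
             exact ((continuous_const.sub (continuous_subtype_val.comp continuous_fst)).mul hf).add
               ((continuous_subtype_val.comp continuous_fst).mul hg)
           map_zero_left := fun x => by ext a; simp
           map_one_left := fun x => by ext a; simp }⟩

open scoped Classical in
/-- Shrink the mass at the vertices in `M` from `t` to `max (2 t - 1) 0`, rescaling the mass at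
the other vertices. -/
noncomputable def shrinkFun {α : Type*} [Fintype α] (M : Set α) (w : α → ℝ) (x : α) : ℝ :=
  if x ∈ M then max (2 * w x - 1) 0
  else w x / max (1 / 2) (1 - ∑ y with y ∈ M, w y)

theorem shrinkFun_support {α : Type*} [Fintype α] {M : Set α} {w : α → ℝ} {x : α}
    (h : shrinkFun M w x ≠ 0) : w x ≠ 0 := by
  intro h0
  apply h
  unfold shrinkFun
  split_ifs <;> simp [h0]

open scoped Classical in
theorem shrinkFun_mem {α : Type*} [Fintype α] {r : α → α → Prop} {M : Set α}
    (hM : ∀ a ∈ M, ∀ b ∈ M, ¬ r a b) {w : α → ℝ} (hw : w ∈ Rl (fullCpx α r)) :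
    shrinkFun M w ∈ Rl (fullCpx α r) := by
  obtain ⟨h0, hs, hc⟩ := mem_Rl_fullCpx.1 hw
  refine mem_Rl_fullCpx.2 ⟨fun a => ?_, ?_, fun a b ha hb =>
    hc a b (shrinkFun_support ha) (shrinkFun_support hb)⟩
  · have := h0 a
    unfold shrinkFun
    split_ifs
    · exact le_max_right _ _
    · exact div_nonneg this (le_trans (by norm_num) (le_max_left _ _))
  · have hsplit := Finset.sum_filter_add_sum_filter_not Finset.univ (fun y => y ∈ M) w
    have hA : 0 ≤ ∑ y with y ∈ M, w y := Finset.sum_nonneg fun y _ => h0 y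
    have hB : 0 ≤ ∑ y with y ∉ M, w y := Finset.sum_nonneg fun y _ => h0 y
    have hmax : ∑ y with y ∈ M, max (2 * w y - 1) 0 =
        max (2 * (∑ y with y ∈ M, w y) - 1) 0 := by
      by_cases hm : ∃ m ∈ M, w m ≠ 0
      · obtain ⟨m, hm, hwm⟩ := hm
        have hz : ∀ y ∈ M, y ≠ m → w y = 0 := by
          intro y hy hym
          by_contra hwy
          exact (hc y m hwy hwm hym).elim (hM y hy m hm) (hM m hm y hy)
        rw [Finset.sum_eq_single m, Finset.sum_eq_single m]
        · intro y hy hym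
          exact hz y (by simpa using hy) hym
        · simp [hm]
        · intro y hy hym
          simp [hz y (by simpa using hy) hym]
        · simp [hm]
      · push Not at hm
        rw [Finset.sum_eq_zero, Finset.sum_eq_zero]
        · simp
        · intro y hy
          exact hm y (by simpa using hy)
        · intro y hy
          simp [hm y (by simpa using hy)]
    unfold shrinkFun
    rw [Finset.sum_ite, hmax, ← Finset.sum_div]
    rw [hs] at hsplit
    rw [show ∑ y with y ∉ M, w y = 1 - ∑ y with y ∈ M, w y by linarith]
    rw [show ∑ y with y ∉ M, w y = 1 - ∑ y with y ∈ M, w y by linarith] at hB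
    generalize ∑ y with y ∈ M, w y = A at *
    rcases le_total A (1 / 2) with h | h
    · rw [max_eq_right (by linarith), max_eq_right (by linarith), div_self (by linarith)]
      simp
    · rw [max_eq_left (by linarith), max_eq_left (by linarith)]
      ring

theorem continuous_shrinkFun {α : Type*} [Fintype α] (M : Set α) :
    Continuous (shrinkFun M) := by
  refine continuous_pi fun x => ?_
  unfold shrinkFun
  split_ifs
  · fun_prop
  · refine Continuous.div (by fun_prop) (by fun_prop) fun w => ?_
    exact (lt_of_lt_of_le (by norm_num) (le_max_left _ _)).ne'

/-- The complement of `M` is a cone with apex `o`; a self-map which pushes the mass off `M` towards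
this cone is homotopic to the identity. -/
theorem homotopic_id_of_push {α : Type*} [Finite α] {r : α → α → Prop} {M : Set α} {o : α}
    (hM : ∀ a ∈ M, ∀ b ∈ M, ¬ r a b) (ho : ∀ x ∉ M, x ≠ o → r o x)
    (q : C(↥(Rl (fullCpx α r)), ↥(Rl (fullCpx α r))))
    (hsupp : ∀ w a, a ≠ o → (q w).1 a ≠ 0 → w.1 a ≠ 0)
    (hlarge : ∀ w, ∀ m ∈ M, 1 / 2 < w.1 m → (q w).1 o = 0)
    (hsmall : ∀ w, (∀ m ∈ M, w.1 m ≤ 1 / 2) → ∀ m ∈ M, (q w).1 m = 0) :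
    q.Homotopic (ContinuousMap.id _) := by
  have := Fintype.ofFinite α
  let p : C(↥(Rl (fullCpx α r)), ↥(Rl (fullCpx α r))) :=
    ⟨fun w => ⟨shrinkFun M w.1, shrinkFun_mem hM w.2⟩,
      ((continuous_shrinkFun M).comp continuous_subtype_val).subtype_mk _⟩
  have hp : ∀ w a, (p w).1 a ≠ 0 → w.1 a ≠ 0 := fun w a h => shrinkFun_support h
  have hqp : q.Homotopic p := by
    refine homotopic_of_contiguous _ _ fun w a b ha hb hab => ?_
    obtain ⟨-, -, hc⟩ := mem_Rl_fullCpx.1 w.2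
    by_cases hw : ∃ m ∈ M, 1 / 2 < w.1 m
    · obtain ⟨m, hm, hwm⟩ := hw
      have hs : ∀ a, ((q w).1 a ≠ 0 ∨ (p w).1 a ≠ 0) → w.1 a ≠ 0 := by
        rintro a (ha | ha)
        · refine hsupp w a ?_ ha
          rintro rfl
          exact ha (hlarge w m hm hwm)
        · exact hp w a ha
      exact hc a b (hs a ha) (hs b hb) hab
    · push Not at hw
      have hs : ∀ a, ((q w).1 a ≠ 0 ∨ (p w).1 a ≠ 0) → a = o ∨ (a ∉ M ∧ w.1 a ≠ 0) := by
        intro a ha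
        refine or_iff_not_imp_left.2 fun hao => ⟨fun haM => ?_, ?_⟩
        · rcases ha with ha | ha
          · exact ha (hsmall w hw a haM)
          · apply ha
            have := hw a haM
            change shrinkFun M w.1 a = 0
            rw [shrinkFun, if_pos haM]
            exact max_eq_right (by linarith)
        · exact ha.elim (hsupp w a hao) (hp w a)
      rcases hs a ha with rfl | ⟨haM, ha0⟩
      · rcases hs b hb with rfl | ⟨hbM, -⟩
        · exact absurd rfl hab
        · exact Or.inl (ho b hbM hab.symm)
      · rcases hs b hb with rfl | ⟨hbM, hb0⟩
        · exact Or.inr (ho a haM hab)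
        · exact hc a b ha0 hb0 hab
  have hpid : p.Homotopic (ContinuousMap.id _) := by
    refine homotopic_of_contiguous _ _ fun w a b ha hb hab => ?_
    obtain ⟨-, -, hc⟩ := mem_Rl_fullCpx.1 w.2
    exact hc a b (ha.elim (hp w a) id) (hb.elim (hp w b) id) hab
  exact hqp.trans hpid

end ChainComplexes

section WedgeOfSuspensions

variable {P : Type*} {rP : P → P → Prop} {M : Set P}

/-- The strict order of the wedge of suspensions of the posets `P_{>m}`, for `m ∈ M`. -/
abbrev upperWedgeRel (rP : P → P → Prop) (M : Set P) :
    WedgeP ↥M (fun m => {x : P // rP m x}) → WedgeP ↥M (fun m => {x : P // rP m x}) → Prop :=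
  wRel (fun (m : ↥M) (a b : {x : P // rP m x}) => rP a.1 b.1)

/-- The vertex map from the wedge of suspensions to the poset with `0̂` adjoined, forgetting
the indices of the wedge summands. -/
def foldVertex : WedgeP ↥M (fun m => {x : P // rP m x}) → Option P
  | none => none
  | some (Sum.inl m) => some m
  | some (Sum.inr x) => some x.2.1

theorem extRel_foldVertex (hmin : ∀ x, ∀ m ∈ M, ¬ rP x m)
    {a b : WedgeP ↥M (fun m => {x : P // rP m x})} (h : upperWedgeRel rP M a b) :
    extRel rP Mᶜ (foldVertex a) (foldVertex b) := by
  match a, b with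
  | none, some (Sum.inr ⟨m, x⟩) => exact fun hx => hmin m x.1 hx x.2
  | some (Sum.inl t), some (Sum.inr ⟨m, x⟩) =>
    obtain rfl : t = m := h
    exact x.2
  | some (Sum.inr ⟨t, y⟩), some (Sum.inr ⟨m, x⟩) =>
    obtain ⟨ht, hr⟩ := h
    dsimp only at ht hr
    subst ht
    exact hr

open scoped Classical in
/-- The simplicial map induced by `foldVertex`. -/
noncomputable def foldFun [Fintype P] (u : WedgeP ↥M (fun m => {x : P // rP m x}) → ℝ)
    (b : Option P) : ℝ :=
  ∑ a with foldVertex a = b, u a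

open scoped Classical in
theorem exists_of_foldFun_ne_zero [Fintype P]
    {u : WedgeP ↥M (fun m => {x : P // rP m x}) → ℝ} {b : Option P} (h : foldFun u b ≠ 0) :
    ∃ a, foldVertex a = b ∧ u a ≠ 0 := by
  obtain ⟨a, ha, hua⟩ := Finset.exists_ne_zero_of_sum_ne_zero h
  exact ⟨a, by simpa using ha, hua⟩

open scoped Classical in
theorem foldFun_mem [Fintype P] (hmin : ∀ x, ∀ m ∈ M, ¬ rP x m)
    {u : WedgeP ↥M (fun m => {x : P // rP m x}) → ℝ}
    (hu : u ∈ Rl (fullCpx _ (upperWedgeRel rP M))) :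
    foldFun u ∈ Rl (fullCpx (Option P) (extRel rP Mᶜ)) := by
  obtain ⟨h0, hs, hc⟩ := mem_Rl_fullCpx.1 hu
  refine mem_Rl_fullCpx.2 ⟨fun a => Finset.sum_nonneg fun y _ => h0 y, ?_, fun a b ha hb hab => ?_⟩
  · unfold foldFun
    rw [Finset.sum_fiberwise, hs]
  · obtain ⟨a', rfl, hua⟩ := exists_of_foldFun_ne_zero ha
    obtain ⟨b', rfl, hub⟩ := exists_of_foldFun_ne_zero hb
    refine (hc a' b' hua hub ?_).imp (extRel_foldVertex hmin) (extRel_foldVertex hmin)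
    rintro rfl
    exact hab rfl

/-- The coordinates other than `0̂` of the collapsing map to the wedge of suspensions. -/
noncomputable def collapseCoord (w : Option P → ℝ) :
    ↥M ⊕ (Σ m : ↥M, {x : P // rP m x}) → ℝ
  | Sum.inl m => max (2 * w (some m) - 1) 0
  | Sum.inr x => min 2 (4 * w (some x.1)) * w (some x.2.1)

open scoped Classical in
/-- The map collapsing the cone `0̂ * Mᶜ` to the vertex `0̂`. -/
noncomputable def collapseFun [Fintype P] (w : Option P → ℝ) :
    WedgeP ↥M (fun m => {x : P // rP m x}) → ℝ
  | none => 1 - ∑ a : ↥M ⊕ (Σ m : ↥M, {x : P // rP m x}), collapseCoord w a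
  | some a => collapseCoord w a

open scoped Classical in
theorem sum_collapseFun [Fintype P] (w : Option P → ℝ) :
    ∑ a : WedgeP ↥M (fun m => {x : P // rP m x}), collapseFun w a = 1 := by
  rw [Fintype.sum_option]
  simp [collapseFun]

theorem eq_zero_of_ne_zero [Fintype P] (hmin : ∀ x, ∀ m ∈ M, ¬ rP x m) {w : Option P → ℝ}
    (hw : w ∈ Rl (fullCpx (Option P) (extRel rP Mᶜ))) {m : P} (hm : m ∈ M)
    (hwm : w (some m) ≠ 0) :
    w none = 0 ∧ ∀ x, x ≠ m → ¬ rP m x → w (some x) = 0 := by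
  obtain ⟨-, -, hc⟩ := mem_Rl_fullCpx.1 hw
  constructor
  · by_contra h
    exact (hc none (some m) h hwm (by simp)).elim (fun h' => h' hm) (fun h' => h')
  · intro x hx hr
    by_contra h
    exact (hc (some x) (some m) h hwm (by simpa using hx)).elim (hmin x m hm) hr

open scoped Classical in
theorem sum_upper [Fintype P] (hmin : ∀ x, ∀ m ∈ M, ¬ rP x m) {w : Option P → ℝ}
    (hw : w ∈ Rl (fullCpx (Option P) (extRel rP Mᶜ))) {m : P} (hm : m ∈ M)
    (hwm : w (some m) ≠ 0) :
    ∑ x : {x : P // rP m x}, w (some x.1) = 1 - w (some m) := by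
  obtain ⟨hnone, hz⟩ := eq_zero_of_ne_zero hmin hw hm hwm
  obtain ⟨-, hs, -⟩ := mem_Rl_fullCpx.1 hw
  rw [Fintype.sum_option, hnone, zero_add] at hs
  rw [← hs, ← Finset.sum_filter_add_sum_filter_not Finset.univ (fun x => rP m x),
    Finset.sum_eq_single (s := Finset.univ.filter fun x => ¬ rP m x) m]
  · rw [add_sub_cancel_right]
    exact (Finset.sum_subtype _ (by simp) fun x => w (some x)).symm
  · intro x hx hxm
    exact hz x hxm (by simpa using hx)
  · simp [hmin m m hm]

open scoped Classical in
theorem sum_collapseCoord [Fintype P] (hmin : ∀ x, ∀ m ∈ M, ¬ rP x m) {w : Option P → ℝ}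
    (hw : w ∈ Rl (fullCpx (Option P) (extRel rP Mᶜ))) {m : P} (hm : m ∈ M)
    (hwm : w (some m) ≠ 0) :
    ∑ a : ↥M ⊕ (Σ m : ↥M, {x : P // rP m x}), collapseCoord w a =
      max (2 * w (some m) - 1) 0 + min 2 (4 * w (some m)) * (1 - w (some m)) := by
  have hz : ∀ t : ↥M, t ≠ ⟨m, hm⟩ → w (some t) = 0 := fun t ht =>
    (eq_zero_of_ne_zero hmin hw hm hwm).2 t (fun h => ht (Subtype.ext h)) (hmin m t t.2)
  rw [Fintype.sum_sum_type, Fintype.sum_sigma, Fintype.sum_eq_single (⟨m, hm⟩ : ↥M),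
    Fintype.sum_eq_single (⟨m, hm⟩ : ↥M)]
  · simp only [collapseCoord]
    rw [← Finset.mul_sum, sum_upper hmin hw hm hwm]
  · intro t ht
    simp [collapseCoord, hz t ht]
  · intro t ht
    simp [collapseCoord, hz t ht]

theorem collapseFun_none_of_ne_zero [Fintype P] (hmin : ∀ x, ∀ m ∈ M, ¬ rP x m)
    {w : Option P → ℝ} (hw : w ∈ Rl (fullCpx (Option P) (extRel rP Mᶜ))) {m : P} (hm : m ∈ M)
    (hwm : w (some m) ≠ 0) :
    collapseFun (rP := rP) (M := M) w none = max (1 - 2 * w (some m)) 0 ^ 2 := by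
  simp only [collapseFun]
  rw [sum_collapseCoord hmin hw hm hwm]
  rcases le_total (w (some m)) (1 / 2) with h | h
  · rw [max_eq_right (by linarith), min_eq_right (by linarith), max_eq_left (by linarith)]
    ring
  · rw [max_eq_left (by linarith), min_eq_left (by linarith), max_eq_right (by linarith)]
    ring

theorem collapseFun_none_of_eq_zero [Fintype P] {w : Option P → ℝ}
    (h : ∀ m ∈ M, w (some m) = 0) : collapseFun (rP := rP) (M := M) w none = 1 := by
  simp only [collapseFun]
  rw [Finset.sum_eq_zero, sub_zero]
  rintro (m | ⟨m, x⟩) -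
  · simp [collapseCoord, h m m.2]
  · simp [collapseCoord, h m m.2]

theorem collapseFun_mem [Fintype P] (hmin : ∀ x, ∀ m ∈ M, ¬ rP x m) {w : Option P → ℝ}
    (hw : w ∈ Rl (fullCpx (Option P) (extRel rP Mᶜ))) :
    collapseFun w ∈ Rl (fullCpx _ (upperWedgeRel rP M)) := by
  classical
  obtain ⟨h0, -, hc⟩ := mem_Rl_fullCpx.1 hw
  have hinl : ∀ m : ↥M, collapseFun (rP := rP) w (some (Sum.inl m)) ≠ 0 →
      1 / 2 < w (some m) := by
    intro m h
    by_contra! hn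
    exact h (max_eq_right (by linarith))
  have hinr : ∀ x, collapseFun (rP := rP) (M := M) w (some (Sum.inr x)) ≠ 0 →
      w (some x.1) ≠ 0 ∧ w (some x.2.1) ≠ 0 := by
    intro x h
    refine ⟨fun h1 => h ?_, fun h1 => h ?_⟩ <;> simp [collapseFun, collapseCoord, h1]
  have huniq : ∀ m m' : ↥M, w (some m) ≠ 0 → w (some m') ≠ 0 → m = m' := by
    intro m m' h h'
    by_contra hne
    exact h' ((eq_zero_of_ne_zero hmin hw m.2 h).2 m' (fun e => hne (Subtype.ext e).symm)
      (hmin _ _ m'.2))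
  have hnone : ∀ m : ↥M, collapseFun (rP := rP) (M := M) w none ≠ 0 →
      ¬ 1 / 2 < w (some m) := by
    intro m h hm
    apply h
    rw [collapseFun_none_of_ne_zero hmin hw m.2 (by linarith), max_eq_right (by linarith)]
    simp
  refine mem_Rl_fullCpx.2 ⟨?_, sum_collapseFun w, ?_⟩
  · rintro (_ | m | x)
    · by_cases h : ∃ m ∈ M, w (some m) ≠ 0
      · obtain ⟨m, hm, hwm⟩ := h
        rw [collapseFun_none_of_ne_zero hmin hw hm hwm]
        positivity
      · push Not at h
        rw [collapseFun_none_of_eq_zero h]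
        exact zero_le_one
    · exact le_max_right _ _
    · have h1 := h0 (some x.1)
      exact mul_nonneg (le_min (by norm_num) (by linarith)) (h0 _)
  · rintro (_ | m | ⟨m, x⟩) (_ | m' | ⟨m', x'⟩) ha hb hab
    · exact absurd rfl hab
    · exact absurd (hinl m' hb) (hnone m' ha)
    · exact Or.inl trivial
    · exact absurd (hinl m ha) (hnone m hb)
    · refine absurd ?_ hab
      rw [huniq m m' (by linarith [hinl m ha]) (by linarith [hinl m' hb])]
    · exact Or.inl (huniq m m' (by linarith [hinl m ha]) (hinr _ hb).1)
    · exact Or.inr trivial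
    · exact Or.inr (huniq m' m (by linarith [hinl m' hb]) (hinr _ ha).1)
    · obtain rfl := huniq m m' (hinr _ ha).1 (hinr _ hb).1
      have hne : x.1 ≠ x'.1 := fun h => hab (by rw [Subtype.ext h])
      exact (hc (some x.1) (some x'.1) (hinr _ ha).2 (hinr _ hb).2 (by simpa using hne)).imp
        (fun h => ⟨rfl, h⟩) (fun h => ⟨rfl, h⟩)

theorem continuous_collapseFun [Fintype P] :
    Continuous (collapseFun (rP := rP) (M := M)) := by
  have hc : ∀ a : ↥M ⊕ (Σ m : ↥M, {x : P // rP m x}),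
      Continuous fun w : Option P → ℝ => collapseCoord w a := by
    rintro (m | x) <;> simp only [collapseCoord] <;> fun_prop
  refine continuous_pi ?_
  rintro (_ | a)
  · exact continuous_const.sub (continuous_finsetSum _ fun a _ => hc a)
  · exact hc a

theorem continuous_foldFun [Fintype P] : Continuous (foldFun (rP := rP) (M := M)) := by
  refine continuous_pi fun b => ?_
  unfold foldFun
  fun_prop

theorem eq_of_foldVertex_inl (hmin : ∀ x, ∀ m ∈ M, ¬ rP x m)
    {a : WedgeP ↥M (fun m => {x : P // rP m x})} {m : ↥M}
    (h : foldVertex a = some (m : P)) : a = some (Sum.inl m) := by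
  match a, h with
  | some (Sum.inl t), h => rw [Subtype.ext (Option.some.inj h)]
  | some (Sum.inr ⟨t, x⟩), h =>
    exact absurd x.2 (by rw [Option.some.inj h]; exact hmin _ _ m.2)

open scoped Classical in
theorem foldFun_some_mem [Fintype P] (hmin : ∀ x, ∀ m ∈ M, ¬ rP x m)
    (u : WedgeP ↥M (fun m => {x : P // rP m x}) → ℝ) (m : ↥M) :
    foldFun u (some (m : P)) = u (some (Sum.inl m)) := by
  unfold foldFun
  rw [Finset.sum_eq_single (some (Sum.inl m))]
  · intro a ha hne
    exact absurd (eq_of_foldVertex_inl hmin (by simpa using ha)) hne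
  · intro h
    exact (h (Finset.mem_filter.2 ⟨Finset.mem_univ _, rfl⟩)).elim

open scoped Classical in
theorem foldFun_none [Fintype P] (u : WedgeP ↥M (fun m => {x : P // rP m x}) → ℝ) :
    foldFun u none = u none := by
  unfold foldFun
  rw [Finset.sum_eq_single none]
  · rintro (_ | m | x) ha hne
    · exact absurd rfl hne
    · cases (Finset.mem_filter.1 ha).2
    · cases (Finset.mem_filter.1 ha).2
  · intro h
    exact (h (Finset.mem_filter.2 ⟨Finset.mem_univ _, rfl⟩)).elim

theorem collapseFun_support [Fintype P] {w : Option P → ℝ}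
    {a : WedgeP ↥M (fun m => {x : P // rP m x})} (ha : a ≠ none) (h : collapseFun w a ≠ 0) :
    w (foldVertex a) ≠ 0 := by
  intro h0
  apply h
  match a with
  | none => exact absurd rfl ha
  | some (Sum.inl m) =>
    simp only [foldVertex] at h0
    simp [collapseFun, collapseCoord, h0]
  | some (Sum.inr x) =>
    simp only [foldVertex] at h0
    simp [collapseFun, collapseCoord, h0]

/-- The complex of `P` with a minimal element `0̂` adjoined below the complement of a set `M` of
minimal elements is homotopy equivalent to the wedge of the suspensions of the `P_{>m}`. -/
noncomputable def collapseEquiv [Fintype P] (hmin : ∀ x, ∀ m ∈ M, ¬ rP x m) :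
    ContinuousMap.HomotopyEquiv ↥(Rl (fullCpx (Option P) (extRel rP Mᶜ)))
      ↥(Rl (fullCpx _ (upperWedgeRel rP M))) where
  toFun := ⟨fun w => ⟨collapseFun w.1, collapseFun_mem hmin w.2⟩,
    (continuous_collapseFun.comp continuous_subtype_val).subtype_mk _⟩
  invFun := ⟨fun u => ⟨foldFun u.1, foldFun_mem hmin u.2⟩,
    (continuous_foldFun.comp continuous_subtype_val).subtype_mk _⟩
  left_inv := by
    refine homotopic_id_of_push (M := some '' M) (o := none) ?_ ?_ _ ?_ ?_ ?_
    · rintro _ ⟨a, -, rfl⟩ _ ⟨b, hb, rfl⟩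
      exact hmin a b hb
    · rintro (_ | x) hx hne
      · exact absurd rfl hne
      · exact fun h => hx ⟨x, h, rfl⟩
    · intro w b hb h
      obtain ⟨a, rfl, ha⟩ := exists_of_foldFun_ne_zero h
      refine collapseFun_support ?_ ha
      rintro rfl
      exact hb rfl
    · rintro w _ ⟨m, hm, rfl⟩ hwm
      change foldFun (collapseFun w.1) none = 0
      rw [foldFun_none, collapseFun_none_of_ne_zero hmin w.2 hm (by linarith),
        max_eq_right (by linarith)]
      simp
    · rintro w hw _ ⟨m, hm, rfl⟩
      change foldFun (collapseFun w.1) (some ((⟨m, hm⟩ : ↥M) : P)) = 0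
      rw [foldFun_some_mem hmin]
      exact max_eq_right (by linarith [hw _ ⟨m, hm, rfl⟩])
  right_inv := by
    classical
    refine homotopic_id_of_push (M := Set.range (some ∘ Sum.inl)) (o := none) ?_ ?_ _ ?_ ?_ ?_
    · rintro _ ⟨a, rfl⟩ _ ⟨b, rfl⟩ h
      exact h
    · rintro (_ | m | x) hx hne
      · exact absurd rfl hne
      · exact absurd ⟨m, rfl⟩ hx
      · trivial
    · rintro u (_ | m | ⟨m, x⟩) hb h
      · exact absurd rfl hb
      · have := collapseFun_support hb h
        change foldFun u.1 (some (m : P)) ≠ 0 at this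
        rwa [foldFun_some_mem hmin] at this
      · have hm : foldFun u.1 (some (m : P)) ≠ 0 := by
          intro h0
          apply h
          change min 2 (4 * foldFun u.1 (some (m : P))) * _ = 0
          simp [h0]
        rw [foldFun_some_mem hmin] at hm
        obtain ⟨a, ha, hua⟩ := exists_of_foldFun_ne_zero (collapseFun_support hb h)
        obtain ⟨-, -, hc⟩ := mem_Rl_fullCpx.1 u.2
        match a, ha, hua with
        | some (Sum.inl t), ha, hua =>
          have hx : t.1 = x.1 := Option.some.inj ha
          exact absurd x.2 (by rw [← hx]; exact hmin _ _ t.2)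
        | some (Sum.inr ⟨t, y⟩), ha, hua =>
          have htm : m = t :=
            (hc (some (Sum.inl m)) (some (Sum.inr ⟨t, y⟩)) hm hua (by simp)).elim id False.elim
          subst htm
          have hyx : y = x := Subtype.ext (Option.some.inj ha)
          rwa [← hyx]
    · rintro u _ ⟨m, rfl⟩ hum
      have hm := foldFun_some_mem hmin u.1 m
      change _ < u.1 (some (Sum.inl m)) at hum
      change collapseFun (foldFun u.1) none = 0
      rw [collapseFun_none_of_ne_zero hmin (foldFun_mem hmin u.2) m.2 (by linarith),
        max_eq_right (by linarith)]
      simp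
    · rintro u hu _ ⟨m, rfl⟩
      have hm := foldFun_some_mem hmin u.1 m
      have hle := hu _ ⟨m, rfl⟩
      change u.1 (some (Sum.inl m)) ≤ _ at hle
      change max (2 * foldFun u.1 (some (m : P)) - 1) 0 = 0
      exact max_eq_right (by linarith)

/-- `τ` is the map of wedges of suspensions induced by the map `φ` of the underlying poset. -/
structure IsInducedBy (φ : P → P)
    (τ : WedgeP ↥M (fun m => {x : P // rP m x}) → WedgeP ↥M (fun m => {x : P // rP m x})) :
    Prop where
  map_none : τ none = none
  map_inl : ∀ m : ↥M, ∃ m' : ↥M, τ (some (Sum.inl m)) = some (Sum.inl m') ∧ m'.1 = φ m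
  map_inr : ∀ (m : ↥M) (x : {x : P // rP m x}), ∃ (m' : ↥M) (x' : {x : P // rP m' x}),
    τ (some (Sum.inr ⟨m, x⟩)) = some (Sum.inr ⟨m', x'⟩) ∧ m'.1 = φ m ∧ x'.1 = φ x

namespace IsInducedBy

variable {φ : P → P}
  {τ : WedgeP ↥M (fun m => {x : P // rP m x}) → WedgeP ↥M (fun m => {x : P // rP m x})}

theorem foldVertex_map (h : IsInducedBy φ τ) (a) :
    foldVertex (τ a) = Option.map φ (foldVertex a) := by
  rcases a with _ | m | ⟨m, x⟩
  · rw [h.map_none]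
    rfl
  · obtain ⟨m', e, hm⟩ := h.map_inl m
    simp [e, foldVertex, hm]
  · obtain ⟨m', x', e, -, hx⟩ := h.map_inr m x
    simp [e, foldVertex, hx]

theorem injective (h : IsInducedBy φ τ) (hφ : Function.Injective φ) :
    Function.Injective τ := by
  have hsigma : ∀ (m m' : ↥M) (x : {x : P // rP m x}) (x' : {x : P // rP m' x}),
      m.1 = m'.1 → x.1 = x'.1 →
        (⟨m, x⟩ : Σ m : ↥M, {x : P // rP m x}) = ⟨m', x'⟩ := by
    rintro ⟨m, hm⟩ ⟨m', hm'⟩ ⟨x, hx⟩ ⟨x', hx'⟩ h1 h2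
    dsimp only at h1 h2
    subst h1 h2
    rfl
  rintro (_ | m | ⟨m, x⟩) (_ | t | ⟨t, y⟩) hab
  · rfl
  · obtain ⟨t', e, -⟩ := h.map_inl t
    rw [h.map_none, e] at hab
    cases hab
  · obtain ⟨t', y', e, -⟩ := h.map_inr t y
    rw [h.map_none, e] at hab
    cases hab
  · obtain ⟨m', e, -⟩ := h.map_inl m
    rw [h.map_none, e] at hab
    cases hab
  · obtain ⟨m', e, hm⟩ := h.map_inl m
    obtain ⟨t', e', ht⟩ := h.map_inl t
    rw [e, e'] at hab
    cases hab
    rw [Subtype.ext (hφ (hm.symm.trans ht))]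
  · obtain ⟨m', e, -⟩ := h.map_inl m
    obtain ⟨t', y', e', -⟩ := h.map_inr t y
    rw [e, e'] at hab
    cases hab
  · obtain ⟨m', x', e, -⟩ := h.map_inr m x
    rw [h.map_none, e] at hab
    cases hab
  · obtain ⟨t', e', -⟩ := h.map_inl t
    obtain ⟨m', x', e, -⟩ := h.map_inr m x
    rw [e, e'] at hab
    cases hab
  · obtain ⟨m', x', e, hm, hx⟩ := h.map_inr m x
    obtain ⟨t', y', e', ht, hy⟩ := h.map_inr t y
    rw [e, e'] at hab
    cases hab
    rw [hsigma m t x y (hφ (hm.symm.trans ht)) (hφ (hx.symm.trans hy))]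

theorem foldFun_comp [Fintype P] (h : IsInducedBy φ τ) (hφ : Function.Injective φ)
    (u : WedgeP ↥M (fun m => {x : P // rP m x}) → ℝ) (b : Option P) :
    foldFun (fun a => u (τ a)) b = foldFun u (Option.map φ b) := by
  classical
  unfold foldFun
  rw [Finset.sum_filter, Finset.sum_filter,
    ← (Finite.injective_iff_bijective.1 (h.injective hφ)).sum_comp fun a =>
      if foldVertex a = Option.map φ b then u a else 0]
  refine Finset.sum_congr rfl fun a _ => ?_
  simp only [h.foldVertex_map, (Option.map_injective hφ).eq_iff]

theorem collapseFun_comp [Fintype P] (h : IsInducedBy φ τ) (hφ : Function.Injective φ)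
    (w : Option P → ℝ) (a : WedgeP ↥M (fun m => {x : P // rP m x})) :
    collapseFun (fun b => w (Option.map φ b)) a = collapseFun w (τ a) := by
  classical
  have hsome : ∀ a : ↥M ⊕ (Σ m : ↥M, {x : P // rP m x}),
      collapseFun (fun b => w (Option.map φ b)) (some a) = collapseFun w (τ (some a)) := by
    rintro (m | ⟨m, x⟩)
    · obtain ⟨m', e, hm⟩ := h.map_inl m
      simp [e, collapseFun, collapseCoord, hm]
    · obtain ⟨m', x', e, hm, hx⟩ := h.map_inr m x
      simp [e, collapseFun, collapseCoord, hm, hx]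
  rcases a with _ | a
  · have h1 := sum_collapseFun (rP := rP) (M := M) fun b => w (Option.map φ b)
    have h2 := sum_collapseFun (rP := rP) (M := M) w
    rw [← (Finite.injective_iff_bijective.1 (h.injective hφ)).sum_comp] at h2
    rw [Fintype.sum_option] at h1 h2
    simp only [hsome] at h1
    linarith
  · exact hsome a

end IsInducedBy

end WedgeOfSuspensions

section Eigenspaces

variable {n : ℕ} {γ : Matrix.GeneralLinearGroup (Fin n) ℂ}
  {G : Subgroup (Matrix.GeneralLinearGroup (Fin n) ℂ)} {ζ : ℂ}

theorem finite_Sp (hG : (G : Set (Matrix.GeneralLinearGroup (Fin n) ℂ)).Finite) :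
    (Sp γ G ζ).Finite := by
  refine (hG.image fun g => eigSp (γ * g) ζ).subset ?_
  rintro E ⟨⟨g, hg, rfl⟩, -⟩
  exact ⟨g, hg, rfl⟩

theorem not_rSp_of_mem_MpSub (x : ↥(Sp γ G ζ)) (m) (hm : m ∈ MpSub γ G ζ) :
    ¬ rSp γ G ζ x m :=
  hm.2 x x.2

theorem Urel_eq_extRel : Urel γ G ζ = extRel (rSp γ G ζ) (MpSub γ G ζ)ᶜ := by
  funext a b
  rcases a with _ | E <;> rcases b with _ | F
  · rfl
  · refine propext ⟨fun h hF => ?_, fun h => ?_⟩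
    · obtain ⟨-, E, hE, hlt⟩ := h
      exact hF.2 E hE hlt
    · refine ⟨F.2, ?_⟩
      by_contra! hn
      exact h ⟨F.2, hn⟩
  · rfl
  · rfl

theorem map_toLin'_matOf_injective (g : ↥G) :
    Function.Injective (Submodule.map (Matrix.toLin' (matOf g))) := by
  refine Submodule.map_injective_of_injective
    (Function.LeftInverse.injective (g := Matrix.toLin' (matOf g⁻¹)) fun v => ?_)
  rw [← LinearMap.comp_apply, ← Matrix.toLin'_mul]
  have : matOf g⁻¹ * matOf g = 1 := by
    simp [matOf]
  rw [this]
  simp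

end Eigenspaces

/-- Theorem 4.2(ii).  For a unitary reflection coset `γG` in `V = ℂⁿ`, a
root of unity `ζ` and `M` the set of maximal eigenspaces, `U'_ζᵛ(γG)` is `G`-equivariantly
homotopy equivalent to the wedge of suspensions `⋁_{m ∈ M} Σ((S'_ζᵛ(γG))_{>m})`.  The
`G`-actions on the two posets (taking images of eigenspaces, permuting wedge summands
according to the action on `M`, and fixing `0̂`) are realized by any order-preserving
vertex maps `σU`, `σW` with the stated values. -/
theorem statement15 {n : ℕ} (γ : Matrix.GeneralLinearGroup (Fin n) ℂ)
    (G : Subgroup (Matrix.GeneralLinearGroup (Fin n) ℂ))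
    (hG : IsUnitaryReflectionGroup G) (hγ : Normalises γ G)
    (ζ : ℂ) (hζ : ∃ m : ℕ, 0 < m ∧ ζ ^ m = 1)
    (σU : ↥G → Option ↥(Sp γ G ζ) → Option ↥(Sp γ G ζ))
    (hσUnone : ∀ g, σU g none = none)
    (hσUval : ∀ (g : ↥G) (E : ↥(Sp γ G ζ)), ∃ F : ↥(Sp γ G ζ),
      σU g (some E) = some F ∧
        (F : Submodule ℂ (Fin n → ℂ)) =
          Submodule.map (Matrix.toLin' (matOf g)) (E : Submodule ℂ (Fin n → ℂ)))
    (hσUmono : ∀ g : ↥G, ∀ ⦃x y⦄, Urel γ G ζ x y → Urel γ G ζ (σU g x) (σU g y))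
    (σW : ↥G → WedgeP ↥(MpSub γ G ζ) (SgtT γ G ζ) → WedgeP ↥(MpSub γ G ζ) (SgtT γ G ζ))
    (hσWnone : ∀ g, σW g none = none)
    (hσWinl : ∀ (g : ↥G) (m : ↥(MpSub γ G ζ)), ∃ m' : ↥(MpSub γ G ζ),
      σW g (some (Sum.inl m)) = some (Sum.inl m') ∧
        ((m' : ↥(Sp γ G ζ)) : Submodule ℂ (Fin n → ℂ)) =
          Submodule.map (Matrix.toLin' (matOf g))
            ((m : ↥(Sp γ G ζ)) : Submodule ℂ (Fin n → ℂ)))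
    (hσWinr : ∀ (g : ↥G) (m : ↥(MpSub γ G ζ)) (E : SgtT γ G ζ m),
      ∃ (m' : ↥(MpSub γ G ζ)) (E' : SgtT γ G ζ m'),
        σW g (some (Sum.inr ⟨m, E⟩)) = some (Sum.inr ⟨m', E'⟩) ∧
        ((m' : ↥(Sp γ G ζ)) : Submodule ℂ (Fin n → ℂ)) =
          Submodule.map (Matrix.toLin' (matOf g))
            ((m : ↥(Sp γ G ζ)) : Submodule ℂ (Fin n → ℂ)) ∧
        ((E'.1 : ↥(Sp γ G ζ)) : Submodule ℂ (Fin n → ℂ)) =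
          Submodule.map (Matrix.toLin' (matOf g))
            ((E.1 : ↥(Sp γ G ζ)) : Submodule ℂ (Fin n → ℂ)))
    (hσWmono : ∀ g : ↥G, ∀ ⦃x y⦄, wRel (rgtS γ G ζ) x y →
      wRel (rgtS γ G ζ) (σW g x) (σW g y)) :
    ∃ F : ContinuousMap.HomotopyEquiv
        ↥(Rl (fullCpx (Option ↥(Sp γ G ζ)) (Urel γ G ζ)))
        ↥(Rl (fullCpx (WedgeP ↥(MpSub γ G ζ) (SgtT γ G ζ)) (wRel (rgtS γ G ζ)))),
      (∀ (g : ↥G) (x y : ↥(Rl (fullCpx (Option ↥(Sp γ G ζ)) (Urel γ G ζ)))),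
        ((y : Option ↥(Sp γ G ζ) → ℝ) =
          fun a => (x : Option ↥(Sp γ G ζ) → ℝ) (σU g⁻¹ a)) →
        ((F.toFun y : WedgeP ↥(MpSub γ G ζ) (SgtT γ G ζ) → ℝ) =
          fun a => (F.toFun x : WedgeP ↥(MpSub γ G ζ) (SgtT γ G ζ) → ℝ) (σW g⁻¹ a))) ∧
      (∀ (g : ↥G)
        (u v : ↥(Rl (fullCpx (WedgeP ↥(MpSub γ G ζ) (SgtT γ G ζ)) (wRel (rgtS γ G ζ))))),
        ((v : WedgeP ↥(MpSub γ G ζ) (SgtT γ G ζ) → ℝ) =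
          fun a => (u : WedgeP ↥(MpSub γ G ζ) (SgtT γ G ζ) → ℝ) (σW g⁻¹ a)) →
        ((F.invFun v : Option ↥(Sp γ G ζ) → ℝ) =
          fun a => (F.invFun u : Option ↥(Sp γ G ζ) → ℝ) (σU g⁻¹ a))) := by
  have := (finite_Sp (γ := γ) (ζ := ζ) hG.1).to_subtype
  have := Fintype.ofFinite ↥(Sp γ G ζ)
  choose φ hφU hφ using hσUval
  have hφinj : ∀ g, Function.Injective (φ g) := fun g x y hxy =>
    Subtype.ext (map_toLin'_matOf_injective g (by rw [← hφ, ← hφ, hxy]))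
  have hU : ∀ g a, σU g a = Option.map (φ g) a := by
    rintro g (_ | E)
    · exact hσUnone g
    · exact hφU g E
  have hW : ∀ g, IsInducedBy (rP := rSp γ G ζ) (M := MpSub γ G ζ) (φ g) (σW g) := by
    refine fun g => ⟨hσWnone g, fun m => ?_, fun m E => ?_⟩
    · obtain ⟨m', e, hm⟩ := hσWinl g m
      exact ⟨m', e, Subtype.ext (hm.trans (hφ g m).symm)⟩
    · obtain ⟨m', E', e, hm, hE⟩ := hσWinr g m E
      exact ⟨m', E', e, Subtype.ext (hm.trans (hφ g m).symm),
        Subtype.ext (hE.trans (hφ g E.1).symm)⟩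
  rw [Urel_eq_extRel]
  refine ⟨collapseEquiv not_rSp_of_mem_MpSub, fun g x y hxy => ?_, fun g u v huv => ?_⟩
  · simp only [hU] at hxy
    funext a
    change collapseFun y.1 a = collapseFun x.1 (σW g⁻¹ a)
    rw [hxy, (hW g⁻¹).collapseFun_comp (hφinj _)]
  · funext b
    change foldFun v.1 b = foldFun u.1 (σU g⁻¹ b)
    rw [huv, hU, (hW g⁻¹).foldFun_comp (hφinj _)]
end
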